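/- arXiv:2210.02788 — 6 statements merged into one kernel-verified Lean document; each statement's English description precedes it below -/
import Mathlib

section
/- (Theorem A, part 1.) Let P = A_0 + A_1 D (A_1 invertible) and Q = Σ_{j=0}^n B_j D^j be MODOs over M_ℓ(K). If there exist a differential field extension Σ of K and a nonzero vector ψ ∈ Σ^ℓ with P(ψ) = 0 and Q(ψ) = 0, then DRes(P,Q) = 0. -/
open Matrix Polynomial Finset

/-- A derivation-like map on a commutative ring: additive and satisfying the Leibniz rule. -/
def IsDeriv {R : Type*} [CommRing R] (d : R → R) : Prop :=
  (∀ a b, d (a + b) = d a + d b) ∧ (∀ a b, d (a * b) = d a * b + a * d b)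

/-- The recursively defined matrices `p_j(N)`:
`p_0(N) = 1`, `p_{j+1}(N) = p_j(N) * N + (p_j(N))'`. -/
def pMat {R : Type*} [CommRing R] (d : R → R) {l : ℕ}
    (N : Matrix (Fin l) (Fin l) R) : ℕ → Matrix (Fin l) (Fin l) R
  | 0 => 1
  | j + 1 => pMat d N j * N + (pMat d N j).map d

/-- Entrywise derivative of a vector. -/
def dVec {R : Type*} (d : R → R) {l : ℕ} (v : Fin l → R) : Fin l → R :=
  fun i => d (v i)

/-- Entrywise derivative of a matrix. -/
def dMat {R : Type*} (d : R → R) {l : ℕ} (A : Matrix (Fin l) (Fin l) R) :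
    Matrix (Fin l) (Fin l) R :=
  A.map d

/-- Action of the first-order operator `P = A₀ + A₁ D` on vectors with entries in a
differential extension `E` of `K` (with embedding `ι` and derivation `dE`). -/
def opP {K E : Type*} [CommRing K] [CommRing E] (ι : K →+* E) (dE : E → E) {l : ℕ}
    (A0 A1 : Matrix (Fin l) (Fin l) K) (ψ : Fin l → E) : Fin l → E :=
  (A0.map ι).mulVec ψ + (A1.map ι).mulVec (dVec dE ψ)

/-- Action of the operator `Q = Σ_{j=0}^n B_j D^j` on vectors with entries in a
differential extension `E` of `K`. -/
def opQ {K E : Type*} [CommRing K] [CommRing E] (ι : K →+* E) (dE : E → E) {l : ℕ}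
    (n : ℕ) (Bc : ℕ → Matrix (Fin l) (Fin l) K) (ψ : Fin l → E) : Fin l → E :=
  ∑ j ∈ Finset.range (n + 1), ((Bc j).map ι).mulVec ((dVec dE)^[j] ψ)

/-- Columnwise action of `Q = Σ_{j=0}^n B_j D^j` on matrices. -/
def opQMat {K E : Type*} [CommRing K] [CommRing E] (ι : K →+* E) (dE : E → E) {l : ℕ}
    (n : ℕ) (Bc : ℕ → Matrix (Fin l) (Fin l) K) (Ψ : Matrix (Fin l) (Fin l) E) :
    Matrix (Fin l) (Fin l) E :=
  ∑ j ∈ Finset.range (n + 1), (Bc j).map ι * (dMat dE)^[j] Ψ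

/-- The matrix `M(P,Q) = Σ_{j=0}^n B_j p_j(N)` with `N = -A₁⁻¹A₀`. -/
noncomputable def MPQ {K : Type*} [Field K] (dK : K → K) {l : ℕ}
    (n : ℕ) (A0 A1 : Matrix (Fin l) (Fin l) K) (Bc : ℕ → Matrix (Fin l) (Fin l) K) :
    Matrix (Fin l) (Fin l) K :=
  ∑ j ∈ Finset.range (n + 1), Bc j * pMat dK (-(A1⁻¹ * A0)) j

/-- Coefficientwise extension of a derivation to polynomials (the variable is a constant). -/
noncomputable def dPoly {K : Type*} [CommRing K] (d : K → K) (p : Polynomial K) : Polynomial K :=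
  p.sum fun n a => Polynomial.C (d a) * Polynomial.X ^ n

/-- `N_λ = -A₁⁻¹ (A₀ - λ·1)` as a matrix over `K[λ]`. -/
noncomputable def Nlam {K : Type*} [Field K] {l : ℕ} (A0 A1 : Matrix (Fin l) (Fin l) K) :
    Matrix (Fin l) (Fin l) (Polynomial K) :=
  -((A1⁻¹).map (Polynomial.C : K →+* Polynomial K) *
      (A0.map (Polynomial.C : K →+* Polynomial K)
        - (Polynomial.X : Polynomial K) • (1 : Matrix (Fin l) (Fin l) (Polynomial K))))

/-- `M(L-λ, B-μ) = Σ_{j=0}^n B_j p_j(N_λ) - μ·1` as a matrix over `K[λ][μ]`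
(inner variable `λ`, outer variable `μ`). -/
noncomputable def Mspec {K : Type*} [Field K] (dK : K → K) {l : ℕ}
    (n : ℕ) (A0 A1 : Matrix (Fin l) (Fin l) K) (Bc : ℕ → Matrix (Fin l) (Fin l) K) :
    Matrix (Fin l) (Fin l) (Polynomial (Polynomial K)) :=
  (∑ j ∈ Finset.range (n + 1),
      (Bc j).map (Polynomial.C.comp Polynomial.C : K →+* Polynomial (Polynomial K)) *
        (pMat (dPoly dK) (Nlam A0 A1) j).map
          (Polynomial.C : Polynomial K →+* Polynomial (Polynomial K)))
    - (Polynomial.X : Polynomial (Polynomial K)) •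
        (1 : Matrix (Fin l) (Fin l) (Polynomial (Polynomial K)))

/-- The differential resultant `f(λ,μ) = det M(L-λ, B-μ)` as an element of `K[λ][μ]`. -/
noncomputable def fSpec {K : Type*} [Field K] (dK : K → K) {l : ℕ}
    (n : ℕ) (A0 A1 : Matrix (Fin l) (Fin l) K) (Bc : ℕ → Matrix (Fin l) (Fin l) K) :
    Polynomial (Polynomial K) :=
  (Mspec dK n A0 A1 Bc).det

/-- Evaluation `K[λ][μ] → E` at `λ = a`, `μ = b` (through `ι : K →+* E`). -/
noncomputable def evalLM {K E : Type*} [CommRing K] [CommRing E] (ι : K →+* E) (a b : E) :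
    Polynomial (Polynomial K) →+* E :=
  Polynomial.eval₂RingHom (Polynomial.eval₂RingHom ι a) b

/-- `N_λ` with `λ` specialized to an element `lam` of an extension `E`. -/
noncomputable def NlamE {K E : Type*} [Field K] [CommRing E] (ι : K →+* E) (lam : E) {l : ℕ}
    (A0 A1 : Matrix (Fin l) (Fin l) K) : Matrix (Fin l) (Fin l) E :=
  -((A1⁻¹).map ι * (A0.map ι - lam • 1))

/-- `g(L,B)` applied to `ψ`, for `g` a polynomial in two variables over `C₀`
(inner variable `λ` substituted by `Lh`, outer variable `μ` substituted by `Bh`). -/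
noncomputable def applyPoly {C₀ E : Type*} [CommRing C₀] [CommRing E] (ιc : C₀ →+* E) {l : ℕ}
    (Lh Bh : (Fin l → E) → (Fin l → E)) (g : Polynomial (Polynomial C₀)) (ψ : Fin l → E) :
    Fin l → E :=
  ∑ i ∈ Finset.range (g.natDegree + 1),
    ∑ k ∈ Finset.range ((g.coeff i).natDegree + 1),
      ιc ((g.coeff i).coeff k) • Lh^[k] (Bh^[i] ψ)

theorem dVec_mulVec_aux {K S : Type*} [Field K] [Field S]
    (dK : K → K) (dS : S → S) (hdS : IsDeriv dS)
    (ι : K →+* S) (hcomp : ∀ a : K, dS (ι a) = ι (dK a)) {l : ℕ}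
    (A : Matrix (Fin l) (Fin l) K) (v : Fin l → S) :
    dVec dS ((A.map ι).mulVec v) =
      ((A.map dK).map ι).mulVec v + (A.map ι).mulVec (dVec dS v) := by
  let D : S →+ S := AddMonoidHom.mk' dS hdS.1
  have hD : ∀ x, dS x = D x := fun _ => rfl
  funext i
  simp only [dVec, Matrix.mulVec, dotProduct, Pi.add_apply, Matrix.map_apply]
  rw [hD, map_sum, ← Finset.sum_add_distrib]
  refine Finset.sum_congr rfl fun j _ => ?_
  rw [← hD, hdS.2, hcomp]

theorem iter_aux {K S : Type*} [Field K] [Field S]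
    (dK : K → K) (dS : S → S) (hdS : IsDeriv dS)
    (ι : K →+* S) (hcomp : ∀ a : K, dS (ι a) = ι (dK a)) {l : ℕ}
    (N : Matrix (Fin l) (Fin l) K) (ψ : Fin l → S)
    (h : dVec dS ψ = (N.map ι).mulVec ψ) (j : ℕ) :
    (dVec dS)^[j] ψ = ((pMat dK N j).map ι).mulVec ψ := by
  induction j with
  | zero => simp [pMat]
  | succ j ih =>
    rw [Function.iterate_succ_apply', ih, dVec_mulVec_aux dK dS hdS ι hcomp, h, pMat,
      Matrix.map_add ι (map_add ι), Matrix.map_mul, Matrix.add_mulVec, Matrix.mulVec_mulVec,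
      add_comm]

/-- Theorem A, part 1: a common nontrivial solution of `PY = 0`, `QY = 0`
in some differential field extension forces `DRes(P,Q) = det M(P,Q) = 0`. -/
theorem statement2 {K S : Type*} [Field K] [Field S] [CharZero K]
    (dK : K → K) (hdK : IsDeriv dK) (dS : S → S) (hdS : IsDeriv dS)
    (ι : K →+* S) (hcomp : ∀ a : K, dS (ι a) = ι (dK a))
    {l : ℕ} (hl : 1 ≤ l)
    (A0 A1 : Matrix (Fin l) (Fin l) K) (hA1 : IsUnit A1.det)
    (n : ℕ) (hn : 1 ≤ n) (Bc : ℕ → Matrix (Fin l) (Fin l) K)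
    (ψ : Fin l → S) (hψ0 : ψ ≠ 0)
    (hP : opP ι dS A0 A1 ψ = 0) (hQ : opQ ι dS n Bc ψ = 0) :
    (MPQ dK n A0 A1 Bc).det = 0 := by
  have hinv : (A1⁻¹.map ι) * (A1.map ι) = 1 := by
    rw [← Matrix.map_mul, Matrix.nonsing_inv_mul _ hA1]
    simp
  have h : dVec dS ψ = ((-(A1⁻¹ * A0)).map ι).mulVec ψ := by
    have h1 := congrArg (fun v => (A1⁻¹.map ι).mulVec v) hP
    simp only [opP, Matrix.mulVec_add, Matrix.mulVec_mulVec, hinv, Matrix.one_mulVec,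
      Matrix.mulVec_zero] at h1
    have h2 : (-(A1⁻¹ * A0)).map ι = -((A1⁻¹.map ι) * (A0.map ι)) := by
      rw [← Matrix.map_mul]
      ext i j
      exact map_neg ι _
    rw [h2, Matrix.neg_mulVec]
    exact eq_neg_of_add_eq_zero_right h1
  have hM : ((MPQ dK n A0 A1 Bc).map ι).mulVec ψ = 0 := by
    rw [← hQ, opQ, MPQ]
    have h3 : (∑ j ∈ Finset.range (n + 1), Bc j * pMat dK (-(A1⁻¹ * A0)) j).map ι
        = ∑ j ∈ Finset.range (n + 1), (Bc j).map ι * (pMat dK (-(A1⁻¹ * A0)) j).map ι := by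
      have := map_sum ι.mapMatrix (fun j => Bc j * pMat dK (-(A1⁻¹ * A0)) j)
        (Finset.range (n + 1))
      simpa only [map_mul, RingHom.mapMatrix_apply] using this
    rw [h3, Matrix.sum_mulVec]
    refine Finset.sum_congr rfl fun j _ => ?_
    rw [iter_aux dK dS hdS ι hcomp _ ψ h j, Matrix.mulVec_mulVec]
  have hdet : ((MPQ dK n A0 A1 Bc).map ι).det = 0 :=
    Matrix.exists_mulVec_eq_zero_iff.mp ⟨ψ, hψ0, hM⟩
  apply ι.injective
  rw [map_zero, RingHom.map_det]
  exact hdet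
end

section
/- (Theorem A, part 2.) Let P = A_0 + A_1 D (A_1 invertible) and Q = Σ_{j=0}^n B_j D^j be MODOs over M_ℓ(K), N = −A_1^{−1}A_0. Let Σ be a differential field extension of K with field of constants C_Σ, and let Ψ ∈ M_ℓ(Σ) be invertible with Ψ′ = N·Ψ. Assume that for each column φ of Ψ the vector Q(φ) again satisfies (Q(φ))′ = N·Q(φ) (this holds whenever P and Q commute). If DRes(P,Q) = 0, then there exist constants c_1, …, c_ℓ ∈ C_Σ, not all zero, such that ψ = c_1 φ_1 + … + c_ℓ φ_ℓ (φ_i the columns of Ψ) is a nonzero vector with P(ψ) = 0 and Q(ψ) = 0. -/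
open Matrix Polynomial Finset

theorem IsDeriv.map_zero' {R : Type*} [CommRing R] {d : R → R} (h : IsDeriv d) : d 0 = 0 := by
  have := h.1 0 0
  simpa using this

theorem IsDeriv.map_sum' {R ι : Type*} [CommRing R] {d : R → R} (h : IsDeriv d)
    (s : Finset ι) (f : ι → R) : d (∑ i ∈ s, f i) = ∑ i ∈ s, d (f i) := by
  classical
  induction s using Finset.induction_on with
  | empty => simpa using h.map_zero'
  | insert a s ha ih => rw [Finset.sum_insert ha, Finset.sum_insert ha, h.1, ih]

theorem IsDeriv.mulVec {R : Type*} [CommRing R] {d : R → R} (h : IsDeriv d) {l : ℕ}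
    (A : Matrix (Fin l) (Fin l) R) (v : Fin l → R) :
    dVec d (A.mulVec v) = (A.map d).mulVec v + A.mulVec (dVec d v) := by
  funext i
  simp [dVec, Matrix.mulVec, dotProduct, h.map_sum', h.2, Finset.sum_add_distrib]

/-- The constants of a differential field. -/
def constSubfield {S : Type*} [Field S] (d : S → S) (h : IsDeriv d) : Subfield S where
  carrier := {a | d a = 0}
  mul_mem' := by
    intro a b ha hb
    simp only [Set.mem_ofPred_eq] at *
    rw [h.2, ha, hb]; simp
  one_mem' := by
    have := h.2 1 1
    simpa using this
  add_mem' := by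
    intro a b ha hb
    simp only [Set.mem_ofPred_eq] at *
    rw [h.1, ha, hb]; simp
  zero_mem' := h.map_zero'
  neg_mem' := by
    intro a ha
    simp only [Set.mem_ofPred_eq] at *
    have := h.1 a (-a)
    rw [add_neg_cancel, h.map_zero', ha, zero_add] at this
    exact this.symm
  inv_mem' := by
    intro a ha
    simp only [Set.mem_ofPred_eq] at *
    by_cases h0 : a = 0
    · rw [h0, _root_.inv_zero, h.map_zero']
    · have h1 : d 1 = 0 := by
        have := h.2 1 1
        simpa using this
      have := h.2 a a⁻¹
      rw [mul_inv_cancel₀ h0, h1, ha, zero_mul, zero_add] at this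
      exact (mul_eq_zero.mp this.symm).resolve_left h0

theorem iter_dVec {K S : Type*} [Field K] [Field S]
    (dK : K → K) (dS : S → S) (hdS : IsDeriv dS)
    (ι : K →+* S) (hcomp : ∀ a : K, dS (ι a) = ι (dK a)) {l : ℕ}
    (N : Matrix (Fin l) (Fin l) K) (φ : Fin l → S)
    (hφ : dVec dS φ = (N.map ι).mulVec φ) (j : ℕ) :
    (dVec dS)^[j] φ = ((pMat dK N j).map ι).mulVec φ := by
  induction j with
  | zero => simp [pMat]
  | succ j ih =>
    have e : ((pMat dK N j).map ι).map dS = ((pMat dK N j).map dK).map ι := by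
      ext a b
      simp [hcomp]
    have e2 : ((pMat dK N j * N + (pMat dK N j).map dK).map ι)
        = (pMat dK N j).map ι * N.map ι + ((pMat dK N j).map dK).map ι := by
      rw [Matrix.map_add ι (by simp), Matrix.map_mul]
    rw [Function.iterate_succ_apply', ih, hdS.mulVec, hφ, pMat, e, e2, Matrix.add_mulVec,
      Matrix.mulVec_mulVec, add_comm]

theorem opQ_eq {K S : Type*} [Field K] [Field S]
    (dK : K → K) (dS : S → S) (hdS : IsDeriv dS)
    (ι : K →+* S) (hcomp : ∀ a : K, dS (ι a) = ι (dK a)) {l : ℕ}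
    (A0 A1 : Matrix (Fin l) (Fin l) K) (n : ℕ) (Bc : ℕ → Matrix (Fin l) (Fin l) K)
    (φ : Fin l → S) (hφ : dVec dS φ = ((-(A1⁻¹ * A0)).map ι).mulVec φ) :
    opQ ι dS n Bc φ = ((MPQ dK n A0 A1 Bc).map ι).mulVec φ := by
  have e : (MPQ dK n A0 A1 Bc).map ι = ∑ j ∈ Finset.range (n + 1),
      (Bc j).map ι * (pMat dK (-(A1⁻¹ * A0)) j).map ι := by
    change ι.mapMatrix _ = _
    rw [MPQ, map_sum]
    refine Finset.sum_congr rfl fun j _ => ?_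
    rw [map_mul]; rfl
  rw [e, Matrix.sum_mulVec, opQ]
  refine Finset.sum_congr rfl fun j _ => ?_
  rw [iter_dVec dK dS hdS ι hcomp _ φ hφ, Matrix.mulVec_mulVec]

/-- Theorem A, part 2: if `DRes(P,Q) = 0` then a suitable constant linear
combination of the columns of a fundamental matrix is a nonzero common solution. -/
theorem statement4 {K S : Type*} [Field K] [Field S] [CharZero K]
    (dK : K → K) (hdK : IsDeriv dK) (dS : S → S) (hdS : IsDeriv dS)
    (ι : K →+* S) (hcomp : ∀ a : K, dS (ι a) = ι (dK a))
    {l : ℕ} (hl : 1 ≤ l)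
    (A0 A1 : Matrix (Fin l) (Fin l) K) (hA1 : IsUnit A1.det)
    (n : ℕ) (hn : 1 ≤ n) (Bc : ℕ → Matrix (Fin l) (Fin l) K)
    (Ψ : Matrix (Fin l) (Fin l) S) (hΨu : IsUnit Ψ.det)
    (hΨ : dMat dS Ψ = (-(A1⁻¹ * A0)).map ι * Ψ)
    (hclosed : ∀ k : Fin l,
      dVec dS (opQ ι dS n Bc fun i => Ψ i k)
        = ((-(A1⁻¹ * A0)).map ι).mulVec (opQ ι dS n Bc fun i => Ψ i k))
    (hres : (MPQ dK n A0 A1 Bc).det = 0) :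
    ∃ c : Fin l → S, (∀ k, dS (c k) = 0) ∧ c ≠ 0 ∧ Ψ.mulVec c ≠ 0 ∧
      opP ι dS A0 A1 (Ψ.mulVec c) = 0 ∧ opQ ι dS n Bc (Ψ.mulVec c) = 0 := by
  set N := -(A1⁻¹ * A0) with hN
  set M := (MPQ dK n A0 A1 Bc).map ι with hM
  have hMdet : M.det = 0 := by
    have : M = ι.mapMatrix (MPQ dK n A0 A1 Bc) := rfl
    rw [this, ← RingHom.map_det, hres, map_zero]
  have hcol : ∀ k, dVec dS (fun i => Ψ i k) = (N.map ι).mulVec (fun i => Ψ i k) := by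
    intro k
    funext i
    exact congrFun (congrFun hΨ i) k
  have hinj : ∀ v : Fin l → S, Ψ.mulVec v = 0 → v = 0 := by
    intro v hv
    have := congrArg (Ψ⁻¹).mulVec hv
    rwa [Matrix.mulVec_mulVec, Matrix.nonsing_inv_mul _ hΨu, Matrix.one_mulVec,
      Matrix.mulVec_zero] at this
  set W := Ψ⁻¹ * (M * Ψ) with hW
  have hΨW : Ψ * W = M * Ψ := by
    rw [hW, ← Matrix.mul_assoc, Matrix.mul_nonsing_inv _ hΨu, Matrix.one_mul]
  have hWdet : W.det = 0 := by
    rw [hW, Matrix.det_mul, Matrix.det_mul, hMdet]; simp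
  have hWc : ∀ i k, dS (W i k) = 0 := by
    intro i k
    have h1 : Ψ.mulVec (fun i => W i k) = opQ ι dS n Bc fun i => Ψ i k := by
      rw [opQ_eq dK dS hdS ι hcomp A0 A1 n Bc _ (hcol k)]
      funext a
      exact congrFun (congrFun hΨW a) k
    have h2 := hclosed k
    rw [← h1, hdS.mulVec] at h2
    have h3 : Ψ.map dS = N.map ι * Ψ := hΨ
    rw [h3, Matrix.mulVec_mulVec] at h2
    have h4 := hinj _ (by simpa using h2)
    exact congrFun h4 i
  let F := constSubfield dS hdS
  let W0 : Matrix (Fin l) (Fin l) F := fun i k => ⟨W i k, hWc i k⟩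
  have hW0 : F.subtype.mapMatrix W0 = W := rfl
  have hW0det : W0.det = 0 := by
    apply F.subtype.injective
    rw [RingHom.map_det, hW0, hWdet, map_zero]
  obtain ⟨c0, hc0, hc0W⟩ := Matrix.exists_mulVec_eq_zero_iff.mpr hW0det
  let c : Fin l → S := fun k => (c0 k : S)
  have hcd : ∀ k, dS (c k) = 0 := fun k => (c0 k).2
  have hcne : c ≠ 0 := by
    intro h
    apply hc0
    funext k
    exact Subtype.ext (congrFun h k)
  have hWcz : W.mulVec c = 0 := by
    funext i
    have := congrArg F.subtype (congrFun hc0W i)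
    rw [RingHom.map_mulVec] at this
    exact this
  have hψ : dVec dS (Ψ.mulVec c) = (N.map ι).mulVec (Ψ.mulVec c) := by
    have h3 : Ψ.map dS = N.map ι * Ψ := hΨ
    have h4 : dVec dS c = 0 := funext hcd
    rw [hdS.mulVec, h3, h4, Matrix.mulVec_zero, add_zero, Matrix.mulVec_mulVec]
  refine ⟨c, hcd, hcne, fun h => hcne (hinj _ h), ?_, ?_⟩
  · have h5 : A1.map ι * N.map ι = - A0.map ι := by
      rw [← Matrix.map_mul, hN, Matrix.mul_neg, ← Matrix.mul_assoc,
        Matrix.mul_nonsing_inv _ hA1, Matrix.one_mul]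
      ext a b
      simp
    rw [opP, hψ, Matrix.mulVec_mulVec _ (A1.map ι), h5, Matrix.neg_mulVec, add_neg_cancel]
  · rw [opQ_eq dK dS hdS ι hcomp A0 A1 n Bc _ hψ, ← hM, Matrix.mulVec_mulVec, ← hΨW,
      ← Matrix.mulVec_mulVec, hWcz, Matrix.mulVec_zero]
end

section
/- (Lemma 4.1.) Let L = A_0 + A_1 D (A_1 invertible) and B = Σ_{j=0}^n B_j D^j (n ≥ 1) be MODOs over M_ℓ(K). The differential resultant f(λ,μ) = det M(L−λ, B−μ) is a polynomial in K[λ,μ] of degree exactly ℓ in μ and degree at most nℓ in λ; more precisely, f(λ,μ) = (−1)^ℓ μ^ℓ + det(B_n)·det(A_1^{−1})^n·λ^{nℓ} + q(λ,μ), where q ∈ K[λ,μ] has degree < ℓ in μ and degree < nℓ in λ. Consequently the degree of f in λ equals nℓ if and only if det(B_n) ≠ 0. -/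
open Matrix Polynomial Finset

def Wt {K : Type*} [CommRing K] (n m : ℕ) (p : Polynomial (Polynomial K)) : Prop :=
  ∀ i k, (p.coeff i).coeff k ≠ 0 → k + n * i ≤ m

theorem Wt.add' {K : Type*} [CommRing K] {n m : ℕ} {p q : Polynomial (Polynomial K)}
    (hp : Wt n m p) (hq : Wt n m q) : Wt n m (p + q) := by
  intro i k h
  by_cases h1 : (p.coeff i).coeff k = 0
  · exact hq i k (by simpa [h1] using h)
  · exact hp i k h1

theorem Wt.mul' {K : Type*} [CommRing K] {n a b : ℕ} {p q : Polynomial (Polynomial K)}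
    (hp : Wt n a p) (hq : Wt n b q) : Wt n (a + b) (p * q) := by
  intro i k h
  rw [Polynomial.coeff_mul, Polynomial.finsetSum_coeff] at h
  obtain ⟨x, hx, h⟩ := Finset.exists_ne_zero_of_sum_ne_zero h
  rw [Polynomial.coeff_mul] at h
  obtain ⟨y, hy, h⟩ := Finset.exists_ne_zero_of_sum_ne_zero h
  have h1 := hp x.1 y.1 (left_ne_zero_of_mul h)
  have h2 := hq x.2 y.2 (right_ne_zero_of_mul h)
  rw [Finset.HasAntidiagonal.mem_antidiagonal] at hx hy
  rw [← hx, ← hy]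
  nlinarith

theorem Wt.prod' {K ι : Type*} [CommRing K] {n : ℕ} (s : Finset ι)
    (p : ι → Polynomial (Polynomial K)) (hp : ∀ i ∈ s, Wt n n (p i)) :
    Wt n (n * s.card) (∏ i ∈ s, p i) := by
  classical
  induction s using Finset.induction_on with
  | empty =>
    intro i k h
    simp only [Finset.prod_empty, Polynomial.coeff_one] at h
    split_ifs at h with h0
    · subst h0
      rw [Polynomial.coeff_one] at h
      split_ifs at h with h1
      · simp [h1]
      · simp at h
    · simp at h
  | insert a s ha ih =>
    rw [Finset.prod_insert ha, Finset.card_insert_of_notMem ha]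
    have := (hp a (by simp)).mul' (ih fun i hi => hp i (by simp [hi]))
    rwa [show n * (s.card + 1) = n + n * s.card by ring]

theorem Wt.det' {K : Type*} [CommRing K] {n l : ℕ}
    (M : Matrix (Fin l) (Fin l) (Polynomial (Polynomial K)))
    (h : ∀ i j, Wt n n (M i j)) : Wt n (n * l) M.det := by
  intro i k hk
  rw [Matrix.det_apply, Polynomial.finsetSum_coeff, Polynomial.finsetSum_coeff] at hk
  obtain ⟨σ, -, hσ⟩ := Finset.exists_ne_zero_of_sum_ne_zero hk
  have := Wt.prod' (n := n) Finset.univ (fun i => M (σ i) i) (fun i _ => h _ _)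
  rw [Finset.card_univ, Fintype.card_fin] at this
  apply this
  intro h0
  apply hσ
  rcases Int.units_eq_one_or (Equiv.Perm.sign σ) with h | h <;> simp [h, h0]

theorem coeff_det' {K : Type*} [CommRing K] {n l : ℕ}
    (M : Matrix (Fin l) (Fin l) (Polynomial K))
    (h : ∀ i j, (M i j).natDegree ≤ n) :
    M.det.coeff (n * l) = (M.map fun p => p.coeff n).det := by
  rw [Matrix.det_apply, Matrix.det_apply, Polynomial.finsetSum_coeff]
  refine Finset.sum_congr rfl fun σ _ => ?_
  have := Polynomial.coeff_prod_of_natDegree_le Finset.univ (fun i => M (σ i) i) n (fun i _ => h _ _)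
  rw [Finset.card_univ, Fintype.card_fin, mul_comm] at this
  rw [Polynomial.coeff_smul, this]
  rfl

theorem dPoly_coeff {K : Type*} [CommRing K] (d : K → K) (h0 : d 0 = 0) (p : Polynomial K) (k : ℕ) :
    (dPoly d p).coeff k = d (p.coeff k) := by
  rw [dPoly, Polynomial.sum, Polynomial.finsetSum_coeff]
  simp only [Polynomial.coeff_C_mul_X_pow]
  rw [Finset.sum_ite_eq]
  split_ifs with h
  · rfl
  · rw [Polynomial.notMem_support_iff.mp h, h0]

theorem Nlam_apply {K : Type*} [Field K] {l : ℕ} (A0 A1 : Matrix (Fin l) (Fin l) K) (i j : Fin l) :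
    Nlam A0 A1 i j = Polynomial.C ((A1⁻¹) i j) * Polynomial.X - Polynomial.C ((A1⁻¹ * A0) i j) := by
  have : Nlam A0 A1 = (Polynomial.X : Polynomial K) • (A1⁻¹).map (Polynomial.C : K →+* Polynomial K)
      - (A1⁻¹ * A0).map (Polynomial.C : K →+* Polynomial K) := by
    rw [Nlam, Matrix.mul_sub, Matrix.map_mul]
    simp
  rw [this]
  rw [Matrix.sub_apply, Matrix.smul_apply, Matrix.map_apply, Matrix.map_apply, smul_eq_mul, mul_comm]

theorem pMat_deg {K : Type*} [Field K] (dK : K → K) (h0 : dK 0 = 0) {l : ℕ}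
    (A0 A1 : Matrix (Fin l) (Fin l) K) (j : ℕ) :
    (∀ a b, (pMat (dPoly dK) (Nlam A0 A1) j a b).natDegree ≤ j) ∧
    (∀ a b, (pMat (dPoly dK) (Nlam A0 A1) j a b).coeff j = ((A1⁻¹) ^ j) a b) := by
  have hN : ∀ a b, (Nlam A0 A1 a b).natDegree ≤ 1 := by
    intro a b
    rw [Nlam_apply]
    compute_degree
  have hN1 : ∀ a b, (Nlam A0 A1 a b).coeff 1 = (A1⁻¹) a b := by
    intro a b
    rw [Nlam_apply]
    simp [Polynomial.coeff_C]
  induction j with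
  | zero =>
    constructor
    · intro a b
      simp only [pMat, Matrix.one_apply]
      split_ifs <;> simp
    · intro a b
      simp only [pMat, Matrix.one_apply, pow_zero]
      split_ifs <;> simp
  | succ j ih =>
    obtain ⟨ih1, ih2⟩ := ih
    have hd : ∀ a b, ∀ k, j < k → (dPoly dK (pMat (dPoly dK) (Nlam A0 A1) j a b)).coeff k = 0 := by
      intro a b k hk
      rw [dPoly_coeff _ h0, Polynomial.coeff_eq_zero_of_natDegree_lt ((ih1 a b).trans_lt hk), h0]
    constructor
    · intro a b
      simp only [pMat, Matrix.add_apply, Matrix.mul_apply, Matrix.map_apply]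
      refine Polynomial.natDegree_add_le_of_degree_le ?_ ?_
      · refine Polynomial.natDegree_sum_le_of_forall_le _ _ fun c _ => ?_
        exact Polynomial.natDegree_mul_le_of_le (ih1 a c) (hN c b)
      · rw [Polynomial.natDegree_le_iff_coeff_eq_zero]
        intro k hk
        exact hd a b k (by omega)
    · intro a b
      simp only [pMat, Matrix.add_apply, Matrix.mul_apply, Matrix.map_apply, pow_succ,
        Polynomial.coeff_add, hd a b (j + 1) (by omega), Polynomial.finsetSum_coeff, add_zero]
      refine Finset.sum_congr rfl fun c _ => ?_
      rw [Polynomial.coeff_mul_add_eq_of_natDegree_le (ih1 a c) (hN c b), ih2, hN1]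

/-- The matrix over `K[λ]`. -/
noncomputable def Pm {K : Type*} [Field K] (dK : K → K) {l : ℕ}
    (n : ℕ) (A0 A1 : Matrix (Fin l) (Fin l) K) (Bc : ℕ → Matrix (Fin l) (Fin l) K) :
    Matrix (Fin l) (Fin l) (Polynomial K) :=
  ∑ j ∈ Finset.range (n + 1),
      (Bc j).map (Polynomial.C : K →+* Polynomial K) * pMat (dPoly dK) (Nlam A0 A1) j

theorem Mspec_eq {K : Type*} [Field K] (dK : K → K) {l : ℕ}
    (n : ℕ) (A0 A1 : Matrix (Fin l) (Fin l) K) (Bc : ℕ → Matrix (Fin l) (Fin l) K) :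
    Mspec dK n A0 A1 Bc = -(Matrix.charmatrix (Pm dK n A0 A1 Bc)) := by
  have h : (Pm dK n A0 A1 Bc).map (Polynomial.C : Polynomial K →+* Polynomial (Polynomial K)) =
    ∑ j ∈ Finset.range (n + 1),
      (Bc j).map (Polynomial.C.comp Polynomial.C : K →+* Polynomial (Polynomial K)) *
        (pMat (dPoly dK) (Nlam A0 A1) j).map
          (Polynomial.C : Polynomial K →+* Polynomial (Polynomial K)) := by
    rw [Pm]
    change (Polynomial.C : Polynomial K →+* Polynomial (Polynomial K)).mapMatrix _ = _
    rw [map_sum]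
    refine Finset.sum_congr rfl fun j _ => ?_
    rw [map_mul]
    rfl
  rw [Mspec, ← h, Matrix.charmatrix, neg_sub, Matrix.smul_one_eq_diagonal, ← Matrix.scalar_apply]
  rfl

theorem Pm_deg {K : Type*} [Field K] (dK : K → K) (h0 : dK 0 = 0) {l : ℕ}
    (n : ℕ) (A0 A1 : Matrix (Fin l) (Fin l) K) (Bc : ℕ → Matrix (Fin l) (Fin l) K) :
    (∀ a b, (Pm dK n A0 A1 Bc a b).natDegree ≤ n) ∧
    ((Pm dK n A0 A1 Bc).map fun p => p.coeff n) = Bc n * (A1⁻¹) ^ n := by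
  have key : ∀ j a b, (((Bc j).map (Polynomial.C : K →+* Polynomial K) *
      pMat (dPoly dK) (Nlam A0 A1) j) a b).natDegree ≤ j := by
    intro j a b
    rw [Matrix.mul_apply]
    refine Polynomial.natDegree_sum_le_of_forall_le _ _ fun c _ => ?_
    rw [Matrix.map_apply]
    exact (Polynomial.natDegree_C_mul_le _ _).trans ((pMat_deg dK h0 A0 A1 j).1 c b)
  constructor
  · intro a b
    rw [Pm, Matrix.sum_apply]
    refine Polynomial.natDegree_sum_le_of_forall_le _ _ fun j hj => ?_
    rw [Finset.mem_range] at hj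
    exact (key j a b).trans (by omega)
  · ext a b
    rw [Matrix.map_apply, Pm, Matrix.sum_apply, Polynomial.finsetSum_coeff, Finset.sum_range_succ,
      Finset.sum_eq_zero, zero_add, Matrix.mul_apply, Matrix.mul_apply, Polynomial.finsetSum_coeff]
    · refine Finset.sum_congr rfl fun c _ => ?_
      rw [Matrix.map_apply, Polynomial.coeff_C_mul, (pMat_deg dK h0 A0 A1 n).2]
    · intro j hj
      rw [Finset.mem_range] at hj
      exact Polynomial.coeff_eq_zero_of_natDegree_lt ((key j a b).trans_lt hj)

/-- Lemma 4.1: the shape and degrees of the differential resultant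
`f(λ,μ) = det M(L-λ, B-μ)` in `K[λ][μ]` (inner variable `λ`, outer variable `μ`). -/
theorem statement7 {K : Type*} [Field K] [CharZero K]
    (dK : K → K) (hdK : IsDeriv dK)
    {l : ℕ} (hl : 1 ≤ l)
    (A0 A1 : Matrix (Fin l) (Fin l) K) (hA1 : IsUnit A1.det)
    (n : ℕ) (hn : 1 ≤ n) (Bc : ℕ → Matrix (Fin l) (Fin l) K) :
    (∃ q : Polynomial (Polynomial K),
      fSpec dK n A0 A1 Bc
          = (-1) ^ l * Polynomial.X ^ l
            + Polynomial.C (Polynomial.C ((Bc n).det * (A1⁻¹).det ^ n)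
                * Polynomial.X ^ (n * l))
            + q
        ∧ q.natDegree < l ∧ ∀ i, (q.coeff i).natDegree < n * l)
    ∧ (fSpec dK n A0 A1 Bc).natDegree = l
    ∧ (∀ i, ((fSpec dK n A0 A1 Bc).coeff i).natDegree ≤ n * l)
    ∧ ((∃ i, ((fSpec dK n A0 A1 Bc).coeff i).natDegree = n * l) ↔ (Bc n).det ≠ 0) := by
  have h0 : dK 0 = 0 := by
    have := hdK.1 0 0
    simpa using this
  obtain ⟨hP1, hP2⟩ := Pm_deg dK h0 n A0 A1 Bc
  set P := Pm dK n A0 A1 Bc with hP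
  set f := fSpec dK n A0 A1 Bc with hf
  have hfc : f = (-1) ^ l * P.charpoly := by
    rw [hf, fSpec, Mspec_eq, Matrix.det_neg, Fintype.card_fin]
    rfl
  have hfcoeff : ∀ i, f.coeff i = (-1) ^ l * P.charpoly.coeff i := by
    intro i
    rw [hfc, show ((-1) ^ l : Polynomial (Polynomial K)) = Polynomial.C ((-1) ^ l) by simp,
      Polynomial.coeff_C_mul]
  have hcd : P.charpoly.natDegree = l := by
    rw [Matrix.charpoly_natDegree_eq_dim, Fintype.card_fin]
  have hcl : P.charpoly.coeff l = 1 := by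
    have := (Matrix.charpoly_monic P).coeff_natDegree
    rwa [hcd] at this
  have hfd : f.natDegree = l := by
    rw [hfc, show ((-1) ^ l : Polynomial (Polynomial K)) = Polynomial.C ((-1) ^ l) by simp,
      Polynomial.natDegree_C_mul (by simp), hcd]
  have hW : Wt n (n * l) f := by
    rw [hf, fSpec]
    apply Wt.det'
    intro a b i k hk
    rw [Mspec_eq, Matrix.neg_apply, Matrix.charmatrix_apply, ← hP, neg_sub, Polynomial.coeff_sub,
      Polynomial.coeff_C, Matrix.diagonal_apply] at hk
    by_cases hi : i = 0
    · subst hi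
      have hz : ((if a = b then Polynomial.X else 0 : Polynomial (Polynomial K)).coeff 0) = 0 := by
        split_ifs <;> simp
      rw [hz] at hk
      simp only [if_true, sub_zero] at hk
      have := (Polynomial.le_natDegree_of_ne_zero hk).trans (hP1 a b)
      simpa using this
    · rw [if_neg hi, zero_sub, Polynomial.coeff_neg] at hk
      split_ifs at hk with hab
      · rw [Polynomial.coeff_X] at hk
        split_ifs at hk with hi1
        · rw [Polynomial.coeff_one] at hk
          split_ifs at hk with hk0
          · simp [← hi1, hk0]
          · simp at hk
        · simp at hk
      · simp at hk
  have hnl : 0 < n * l := by positivity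
  have hinv : (A1⁻¹).det ≠ 0 := by
    rw [Matrix.det_nonsing_inv]
    simpa using hA1.ne_zero
  set c := (Bc n).det * (A1⁻¹).det ^ n with hc
  have htop : (f.coeff 0).coeff (n * l) = c := by
    have h1 : f.coeff 0 = P.det := by
      rw [hfcoeff, Matrix.det_eq_sign_charpoly_coeff, Fintype.card_fin]
    rw [h1, coeff_det' P hP1, hP2, Matrix.det_mul, Matrix.det_pow]
  have hfl : f.coeff l = (-1) ^ l := by rw [hfcoeff, hcl, mul_one]
  have hle : ∀ i, (f.coeff i).natDegree ≤ n * l := by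
    intro i
    rw [Polynomial.natDegree_le_iff_coeff_eq_zero]
    intro k hk
    by_contra h
    have := hW i k h
    omega
  have hpos : ∀ i, i ≠ 0 → ∀ k, n * l ≤ k → (f.coeff i).coeff k = 0 := by
    intro i hi k hk
    by_contra h
    have := hW i k h
    have : 0 < n * i := Nat.mul_pos hn (Nat.pos_of_ne_zero hi)
    omega
  have hm1 : ((-1) ^ l : Polynomial (Polynomial K)) = Polynomial.C ((-1) ^ l) := by simp
  have hm2 : ((-1) ^ l : Polynomial K) = Polynomial.C ((-1) ^ l) := by simp
  refine ⟨⟨f - ((-1) ^ l * Polynomial.X ^ l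
            + Polynomial.C (Polynomial.C c * Polynomial.X ^ (n * l))), by ring, ?_, ?_⟩,
    hfd, hle, ?_⟩
  · have : ∀ k, l - 1 < k → (f - ((-1) ^ l * Polynomial.X ^ l
            + Polynomial.C (Polynomial.C c * Polynomial.X ^ (n * l)))).coeff k = 0 := by
      intro k hk
      rw [Polynomial.coeff_sub, Polynomial.coeff_add, hm1, Polynomial.coeff_C_mul_X_pow,
        Polynomial.coeff_C, if_neg (by omega : ¬ k = 0), add_zero]
      split_ifs with hkl
      · rw [hkl, hfl, sub_self]
      · rw [Polynomial.coeff_eq_zero_of_natDegree_lt (by omega), sub_zero]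
    have := Polynomial.natDegree_le_iff_coeff_eq_zero.mpr this
    omega
  · intro i
    have : ∀ k, n * l - 1 < k → ((f - ((-1) ^ l * Polynomial.X ^ l
            + Polynomial.C (Polynomial.C c * Polynomial.X ^ (n * l)))).coeff i).coeff k = 0 := by
      intro k hk
      rw [Polynomial.coeff_sub, Polynomial.coeff_add, hm1, Polynomial.coeff_C_mul_X_pow,
        Polynomial.coeff_C]
      by_cases hi : i = 0
      · subst hi
        rw [if_neg (by omega : ¬ 0 = l), if_pos rfl, zero_add, Polynomial.coeff_sub,
          Polynomial.coeff_C_mul_X_pow]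
        split_ifs with hkl
        · rw [hkl, htop, sub_self]
        · rw [Polynomial.coeff_eq_zero_of_natDegree_lt ((hle 0).trans_lt (by omega)), sub_zero]
      · rw [if_neg hi, add_zero, Polynomial.coeff_sub, hpos i hi k (by omega), zero_sub, neg_eq_zero]
        split_ifs
        · rw [hm2, Polynomial.coeff_C, if_neg (by omega)]
        · simp
    have := Polynomial.natDegree_le_iff_coeff_eq_zero.mpr this
    omega
  · have hcB : c ≠ 0 ↔ (Bc n).det ≠ 0 := by
      rw [hc]
      simp [hA1.ne_zero]
    rw [← hcB]
    constructor
    · rintro ⟨i, hi⟩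
      have hne : (f.coeff i).coeff (n * l) ≠ 0 := by
        rw [← hi, Polynomial.coeff_natDegree, Polynomial.leadingCoeff_ne_zero]
        intro hz
        rw [hz, Polynomial.natDegree_zero] at hi
        omega
      by_cases hi0 : i = 0
      · rwa [hi0, htop] at hne
      · exact absurd (hpos i hi0 _ le_rfl) hne
    · intro h
      exact ⟨0, le_antisymm (hle 0) (Polynomial.le_natDegree_of_ne_zero (by rwa [htop]))⟩
end

section
/- (Corollary 4.1, coupled spectral problem.) Let L = A_0 + A_1 D (A_1 invertible) and B = Σ_{j=0}^n B_j D^j (n ≥ 1) be MODOs over M_ℓ(K), and let f(λ,μ) = det M(L−λ, B−μ) ∈ K[λ,μ]. For any point (λ_0, μ_0) ∈ C × C: (i) the evaluation of f at (λ_0, μ_0) equals DRes(L − λ_0, B − μ_0) = det M(L−λ_0, B−μ_0), where L − λ_0 = (A_0 − λ_0 I_ℓ) + A_1 D and B − μ_0 = (B_0 − μ_0 I_ℓ) + Σ_{j=1}^n B_j D^j; and (ii) if Σ_0 is a differential field extension of K carrying an invertible solution matrix Ψ of Ψ′ = N_{λ_0}·Ψ with N_{λ_0} = −A_1^{−1}(A_0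 − λ_0 I_ℓ), and B − μ_0 maps solutions of Y′ = N_{λ_0}Y to solutions, then the system L(Y) = λ_0 Y, B(Y) = μ_0 Y has a nonzero solution in Σ_0^ℓ if and only if f(λ_0, μ_0) = 0. -/
open Matrix Polynomial Finset

namespace St10

variable {R T : Type*} [CommRing R] [CommRing T]

lemma d_zero {d : R → R} (h : IsDeriv d) : d 0 = 0 := by
  have := h.1 0 0
  simpa using this

lemma d_one {d : R → R} (h : IsDeriv d) : d 1 = 0 := by
  have := h.2 1 1
  simpa using this

lemma d_neg {d : R → R} (h : IsDeriv d) (a : R) : d (-a) = - d a := by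
  have := h.1 (-a) a
  rw [neg_add_cancel, d_zero h] at this
  exact eq_neg_of_add_eq_zero_left this.symm

lemma d_sum {d : R → R} (h : IsDeriv d) {α : Type*} (s : Finset α) (f : α → R) :
    d (∑ i ∈ s, f i) = ∑ i ∈ s, d (f i) :=
  map_sum (AddMonoidHom.mk' d h.1) f s

lemma d_pow {d : R → R} (h : IsDeriv d) {a : R} (ha : d a = 0) (n : ℕ) : d (a ^ n) = 0 := by
  induction n with
  | zero => simpa using d_one h
  | succ k ih => rw [pow_succ, h.2, ih, ha]; simp

lemma d_mul_mat {d : R → R} (h : IsDeriv d) {l : ℕ} (A B : Matrix (Fin l) (Fin l) R) :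
    (A * B).map d = A.map d * B + A * B.map d := by
  ext i j
  simp [Matrix.mul_apply, d_sum h, h.2, Finset.sum_add_distrib]

lemma d_mulVec {d : R → R} (h : IsDeriv d) {l : ℕ} (A : Matrix (Fin l) (Fin l) R)
    (v : Fin l → R) :
    dVec d (A.mulVec v) = (A.map d).mulVec v + A.mulVec (dVec d v) := by
  ext i
  simp [dVec, Matrix.mulVec, dotProduct, d_sum h, h.2, Finset.sum_add_distrib]

lemma pMat_map {d : R → R} {d' : T → T} (φ : R →+* T) (h : ∀ a, φ (d a) = d' (φ a)) {l : ℕ}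
    (N : Matrix (Fin l) (Fin l) R) (j : ℕ) :
    (pMat d N j).map φ = pMat d' (N.map φ) j := by
  induction j with
  | zero => simp [pMat]
  | succ k ih =>
    rw [pMat, pMat, Matrix.map_add _ (map_add φ), Matrix.map_mul, ih]
    congr 1
    rw [← ih]
    ext a b
    simp [h]

lemma iter_sol {d : R → R} (h : IsDeriv d) {l : ℕ} (N : Matrix (Fin l) (Fin l) R)
    (v : Fin l → R) (hv : dVec d v = N.mulVec v) (j : ℕ) :
    (dVec d)^[j] v = (pMat d N j).mulVec v := by
  induction j with
  | zero => simp [pMat]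
  | succ k ih =>
    rw [Function.iterate_succ_apply', ih, d_mulVec h, hv, pMat, Matrix.add_mulVec,
      Matrix.mulVec_mulVec, add_comm]

lemma eval_dPoly {d : R → R} (h : IsDeriv d) {a : R} (ha : d a = 0) (p : Polynomial R) :
    (dPoly d p).eval a = d (p.eval a) := by
  induction p using Polynomial.induction_on' with
  | add p q hp hq =>
    have : dPoly d (p + q) = dPoly d p + dPoly d q := by
      unfold dPoly
      apply Polynomial.sum_add_index
      · intro i; simp [d_zero h]
      · intro i b c; simp [h.1, add_mul]
    rw [this, Polynomial.eval_add, hp, hq, Polynomial.eval_add, h.1]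
  | monomial n b =>
    have : dPoly d (Polynomial.monomial n b) = Polynomial.C (d b) * Polynomial.X ^ n := by
      unfold dPoly
      apply Polynomial.sum_monomial_index
      simp [d_zero h]
    rw [this]
    simp [Polynomial.eval_monomial, h.2, d_pow h ha]

/-- constants -/
def constSub {S : Type*} [Field S] (d : S → S) (h : IsDeriv d) : Subfield S where
  carrier := {a | d a = 0}
  mul_mem' := by
    intro a b ha hb
    simp only [Set.mem_ofPred_eq] at *
    rw [h.2, ha, hb]; simp
  one_mem' := d_one h
  add_mem' := by
    intro a b ha hb
    simp only [Set.mem_ofPred_eq] at *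
    rw [h.1, ha, hb]; simp
  zero_mem' := d_zero h
  neg_mem' := by
    intro a ha
    simp only [Set.mem_ofPred_eq] at *
    rw [d_neg h, ha]; simp
  inv_mem' := by
    intro a ha
    simp only [Set.mem_ofPred_eq] at *
    by_cases h0 : a = 0
    · simp [h0, d_zero h]
    · have := h.2 a a⁻¹
      rw [mul_inv_cancel₀ h0, d_one h, ha, zero_mul, zero_add] at this
      exact (mul_eq_zero.mp this.symm).resolve_left h0

lemma exists_const {S : Type*} [Field S] (d : S → S) (h : IsDeriv d) {l : ℕ}
    (G : Matrix (Fin l) (Fin l) S) (hG : G.map d = 0) (hdet : G.det = 0) :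
    ∃ c : Fin l → S, c ≠ 0 ∧ dVec d c = 0 ∧ G.mulVec c = 0 := by
  let G' : Matrix (Fin l) (Fin l) (constSub d h) :=
    Matrix.of fun i j => ⟨G i j, congrFun (congrFun hG i) j⟩
  have hm : G'.map (constSub d h).subtype = G := by ext i j; rfl
  have hd : G'.det = 0 := by
    apply (constSub d h).subtype.injective
    rw [RingHom.map_det, map_zero]
    change (G'.map (constSub d h).subtype).det = 0
    rw [hm, hdet]
  obtain ⟨c, hc, hGc⟩ := Matrix.exists_mulVec_eq_zero_iff.mpr hd
  refine ⟨fun i => c i, ?_, ?_, ?_⟩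
  · intro h0
    apply hc
    ext i
    exact congrFun h0 i
  · ext i
    exact (c i).2
  · ext i
    have := congrArg (constSub d h).subtype (congrFun hGc i)
    rw [RingHom.map_mulVec] at this
    rw [hm] at this
    exact this

lemma Nlam_eval {K : Type*} [Field K] {l : ℕ} (A0 A1 : Matrix (Fin l) (Fin l) K) (a : K) :
    (Nlam A0 A1).map (Polynomial.evalRingHom a) = -(A1⁻¹ * (A0 - a • 1)) := by
  ext i j
  simp [Nlam, Matrix.mul_apply, Polynomial.eval_finsetSum, Matrix.one_apply, apply_ite]

lemma MPQ_eq {K : Type*} [Field K] (dK : K → K) {l : ℕ} (n : ℕ)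
    (A0 A1 : Matrix (Fin l) (Fin l) K) (Bc : ℕ → Matrix (Fin l) (Fin l) K) (mu : K) :
    MPQ dK n A0 A1 (fun j => if j = 0 then Bc 0 - mu • 1 else Bc j)
      = MPQ dK n A0 A1 Bc - mu • 1 := by
  simp [MPQ, Finset.sum_range_succ', pMat, add_sub_assoc]

lemma part1 {K : Type*} [Field K] (dK : K → K) (hdK : IsDeriv dK) {l : ℕ} (n : ℕ)
    (A0 A1 : Matrix (Fin l) (Fin l) K) (Bc : ℕ → Matrix (Fin l) (Fin l) K) (lam mu : K)
    (hlam : dK lam = 0) :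
    evalLM (RingHom.id K) lam mu (fSpec dK n A0 A1 Bc)
      = (MPQ dK n (A0 - lam • 1) A1 Bc - mu • 1).det := by
  rw [fSpec, RingHom.map_det]
  congr 1
  have key : ∀ j, pMat dK (-(A1⁻¹ * (A0 - lam • 1))) j
      = (pMat (dPoly dK) (Nlam A0 A1) j).map (Polynomial.evalRingHom lam) := by
    intro j
    rw [pMat_map (d' := dK) (Polynomial.evalRingHom lam) (fun p => eval_dPoly hdK hlam p),
      Nlam_eval]
  ext a b
  simp only [MPQ, key]
  by_cases hab : a = b <;>
  simp [Mspec, evalLM, Matrix.sum_apply, Matrix.mul_apply, Matrix.one_apply, hab,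
    Polynomial.eval₂_finsetSum]

lemma part2 {K S : Type*} [Field K] [Field S] (dK : K → K) (dS : S → S) (hdS : IsDeriv dS)
    (ι : K →+* S) (hcomp : ∀ a : K, dS (ι a) = ι (dK a)) {l : ℕ} (n : ℕ)
    (A0 A1 : Matrix (Fin l) (Fin l) K) (Bc : ℕ → Matrix (Fin l) (Fin l) K) (mu : K)
    (ψ : Fin l → S) (h : dVec dS ψ = ((-(A1⁻¹ * A0)).map ι).mulVec ψ) :
    opQ ι dS n Bc ψ - ι mu • ψ = ((MPQ dK n A0 A1 Bc - mu • 1).map ι).mulVec ψ := by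
  have e : (MPQ dK n A0 A1 Bc - mu • 1).map ι
      = (∑ j ∈ Finset.range (n + 1), (Bc j).map ι * (pMat dK (-(A1⁻¹ * A0)) j).map ι)
        - ι mu • 1 := by
    ext a b
    by_cases hab : a = b <;>
    simp [MPQ, Matrix.sum_apply, Matrix.mul_apply, Matrix.one_apply, hab]
  rw [e, Matrix.sub_mulVec, Matrix.smul_mulVec, Matrix.one_mulVec, Matrix.sum_mulVec, opQ]
  congr 1
  refine Finset.sum_congr rfl fun j _ => ?_
  rw [iter_sol hdS _ _ h, pMat_map (d' := dS) ι (fun a => (hcomp a).symm), Matrix.mulVec_mulVec]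

lemma opP_iff {K S : Type*} [Field K] [Field S] (dS : S → S)
    (ι : K →+* S) {l : ℕ}
    (A0 A1 : Matrix (Fin l) (Fin l) K) (hA1 : IsUnit A1.det) (lam : K) (ψ : Fin l → S) :
    opP ι dS A0 A1 ψ = ι lam • ψ ↔
      dVec dS ψ = ((-(A1⁻¹ * (A0 - lam • 1))).map ι).mulVec ψ := by
  have e0 : (A0 - lam • 1).map ι = A0.map ι - ι lam • 1 := by
    ext a b
    by_cases hab : a = b <;> simp [Matrix.one_apply, hab]
  have e1 : (-(A1⁻¹ * (A0 - lam • 1))).map ι = -((A1⁻¹).map ι * (A0.map ι - ι lam • 1)) := by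
    rw [← e0, ← Matrix.map_mul]
    ext a b
    exact map_neg ι _
  have i1 : A1.map ι * (A1⁻¹).map ι = 1 := by
    rw [← Matrix.map_mul, Matrix.mul_nonsing_inv _ hA1]; simp
  have i2 : (A1⁻¹).map ι * A1.map ι = 1 := by
    rw [← Matrix.map_mul, Matrix.nonsing_inv_mul _ hA1]; simp
  rw [e1, opP]
  constructor
  · intro h
    have h2 : (A1.map ι).mulVec (dVec dS ψ) = -((A0.map ι - ι lam • 1).mulVec ψ) := by
      rw [Matrix.sub_mulVec, Matrix.smul_mulVec, Matrix.one_mulVec, ← h]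
      abel
    have h3 := congrArg ((A1⁻¹).map ι).mulVec h2
    rw [Matrix.mulVec_mulVec, i2, Matrix.one_mulVec, Matrix.mulVec_neg,
      Matrix.mulVec_mulVec] at h3
    rw [h3, Matrix.neg_mulVec]
  · intro h
    rw [h, Matrix.neg_mulVec, Matrix.mulVec_neg, Matrix.mulVec_mulVec, ← Matrix.mul_assoc, i1,
      Matrix.one_mul, Matrix.sub_mulVec, Matrix.smul_mulVec, Matrix.one_mulVec]
    abel

end St10

/-- Corollary 4.1: evaluating `f(λ,μ)` at a point `(λ₀,μ₀)` of constants
gives `DRes(L-λ₀, B-μ₀)`, and the coupled spectral problem `LY = λ₀Y`, `BY = μ₀Y` has a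
nonzero solution iff `f(λ₀,μ₀) = 0`. -/
theorem statement10 {K S : Type*} [Field K] [Field S] [CharZero K]
    (dK : K → K) (hdK : IsDeriv dK) (dS : S → S) (hdS : IsDeriv dS)
    (ι : K →+* S) (hcomp : ∀ a : K, dS (ι a) = ι (dK a))
    {l : ℕ} (hl : 1 ≤ l)
    (A0 A1 : Matrix (Fin l) (Fin l) K) (hA1 : IsUnit A1.det)
    (n : ℕ) (hn : 1 ≤ n) (Bc : ℕ → Matrix (Fin l) (Fin l) K) :
    ∀ lam0 mu0 : K, dK lam0 = 0 → dK mu0 = 0 →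
      (evalLM (RingHom.id K) lam0 mu0 (fSpec dK n A0 A1 Bc)
          = (MPQ dK n (A0 - lam0 • 1) A1
              (fun j => if j = 0 then Bc 0 - mu0 • 1 else Bc j)).det)
      ∧ (∀ Ψ0 : Matrix (Fin l) (Fin l) S, IsUnit Ψ0.det →
          dMat dS Ψ0 = (-(A1⁻¹ * (A0 - lam0 • 1))).map ι * Ψ0 →
          (∀ ψ : Fin l → S, dVec dS ψ = ((-(A1⁻¹ * (A0 - lam0 • 1))).map ι).mulVec ψ →
            dVec dS (opQ ι dS n Bc ψ - ι mu0 • ψ)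
              = ((-(A1⁻¹ * (A0 - lam0 • 1))).map ι).mulVec (opQ ι dS n Bc ψ - ι mu0 • ψ)) →
          ((∃ ψ : Fin l → S, ψ ≠ 0 ∧ opP ι dS A0 A1 ψ = ι lam0 • ψ
              ∧ opQ ι dS n Bc ψ = ι mu0 • ψ)
            ↔ evalLM (RingHom.id K) lam0 mu0 (fSpec dK n A0 A1 Bc) = 0)) := by
  intro lam0 mu0 hlam hmu
  have h1 := St10.part1 dK hdK n A0 A1 Bc lam0 mu0 hlam
  refine ⟨by rw [St10.MPQ_eq, h1], ?_⟩
  intro Ψ hΨ hdΨ hcomm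
  rw [h1]
  have hQ := St10.part2 dK dS hdS ι hcomp n (A0 - lam0 • 1) A1 Bc mu0
  have hP := St10.opP_iff dS ι A0 A1 hA1 lam0
  generalize (-(A1⁻¹ * (A0 - lam0 • 1))).map ι = N at *
  generalize MPQ dK n (A0 - lam0 • 1) A1 Bc - mu0 • 1 = M at *
  have hdet : M.det = 0 ↔ (M.map ι).det = 0 := by
    have : (M.map ι).det = ι M.det := (RingHom.map_det ι M).symm
    rw [this, map_eq_zero]
  rw [hdet]
  generalize M.map ι = M' at *
  constructor
  · rintro ⟨ψ, h0, hL, hB⟩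
    have h2 := hQ ψ ((hP ψ).1 hL)
    rw [hB, sub_self] at h2
    exact Matrix.exists_mulVec_eq_zero_iff.mp ⟨ψ, h0, h2.symm⟩
  · intro hM
    have hcol : ∀ j, dVec dS (fun i => Ψ i j) = N.mulVec (fun i => Ψ i j) := by
      intro j
      ext i
      exact congrFun (congrFun hdΨ i) j
    have hMΨ : (M' * Ψ).map dS = N * (M' * Ψ) := by
      ext i j
      have h3 := hcomm _ (hcol j)
      rw [hQ _ (hcol j)] at h3
      exact congrFun h3 i
    set G := Ψ⁻¹ * (M' * Ψ) with hG
    have hΨG : Ψ * G = M' * Ψ := by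
      rw [hG, ← Matrix.mul_assoc, Matrix.mul_nonsing_inv _ hΨ, Matrix.one_mul]
    have hdG : G.map dS = 0 := by
      have h4 := St10.d_mul_mat hdS Ψ G
      have h5 : Ψ.map dS = N * Ψ := hdΨ
      rw [hΨG, hMΨ, h5, Matrix.mul_assoc, hΨG] at h4
      have h6 : Ψ * G.map dS = 0 := by simpa using h4
      have h7 := congrArg (fun Z => Ψ⁻¹ * Z) h6
      simpa [← Matrix.mul_assoc, Matrix.nonsing_inv_mul _ hΨ] using h7
    have hGdet : G.det = 0 := by simp [hG, hM]
    obtain ⟨c, hc0, hcd, hGc⟩ := St10.exists_const dS hdS G hdG hGdet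
    have hsol : dVec dS (Ψ.mulVec c) = N.mulVec (Ψ.mulVec c) := by
      have h5 : Ψ.map dS = N * Ψ := hdΨ
      rw [St10.d_mulVec hdS, hcd, h5, Matrix.mulVec_zero, add_zero, Matrix.mulVec_mulVec]
    refine ⟨Ψ.mulVec c, ?_, (hP _).2 hsol, ?_⟩
    · intro h0
      apply hc0
      have h7 := congrArg Ψ⁻¹.mulVec h0
      simpa [Matrix.mulVec_mulVec, Matrix.nonsing_inv_mul _ hΨ] using h7
    · rw [← sub_eq_zero, hQ _ hsol, Matrix.mulVec_mulVec, ← hΨG, ← Matrix.mulVec_mulVec, hGc,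
        Matrix.mulVec_zero]
end

section
/- (Lemma 5.4.) Assume L̂ ∘ B̂ = B̂ ∘ L̂ on E^ℓ and let Ψ ∈ M_ℓ(E) be a fundamental matrix for L − λ; set Δ = Ψ^{−1}·(B̂(Ψ) − μΨ) (a matrix with constant entries), M = M(L−λ, B−μ) and M_λ = M + μ I_ℓ, viewed in M_ℓ(E). Then for every polynomial g(λ,μ) = Σ_{i=0}^p a_i(λ)·μ^i in C[λ,μ] the identity g(λ,μ)·Ψ = Σ_{i=0}^p a_i(λ)·B̂^i(Ψ) + Θ(g)·Ψ·Δ holds in M_ℓ(E), where Θ(g) = Σ_{i=1}^p a_i(λ)·Σ_{k=0}^{i−1} (−1)^{i−k}·binom(i,k)·M_λ^k·M^{i−1−k} is a matrix each of whose entries is the evaluation in E of a polynomial in K[λ,μ]; moreover det Δ = f(λ,μ) = det M(L−λ, B−μ). -/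
open Matrix Polynomial Finset

namespace S12

section
variable {R : Type*} [CommRing R] {d : R → R} (hd : IsDeriv d) {l : ℕ}

lemma d_zero (hd : IsDeriv d) : d 0 = 0 := by
  have h := hd.1 0 0
  simpa using h

lemma d_one (hd : IsDeriv d) : d 1 = 0 := by
  have h := hd.2 1 1
  simpa using h

lemma d_sum (hd : IsDeriv d) {α : Type*} (s : Finset α) (f : α → R) :
    d (∑ i ∈ s, f i) = ∑ i ∈ s, d (f i) :=
  map_sum (AddMonoidHom.mk' d hd.1) f s

lemma dMat_mul (hd : IsDeriv d) (A B : Matrix (Fin l) (Fin l) R) :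
    dMat d (A * B) = dMat d A * B + A * dMat d B := by
  ext i j
  simp [dMat, Matrix.mul_apply, d_sum hd, hd.2, Finset.sum_add_distrib]

lemma dMat_add (hd : IsDeriv d) (A B : Matrix (Fin l) (Fin l) R) :
    dMat d (A + B) = dMat d A + dMat d B := by
  ext i j
  simp [dMat, hd.1]

lemma dMat_scalar (hd : IsDeriv d) {c : R} (hc : d c = 0) :
    dMat d (c • (1 : Matrix (Fin l) (Fin l) R)) = 0 := by
  ext i j
  by_cases h : i = j
  · simp [dMat, h, hc]
  · simp [dMat, h, d_zero hd]

lemma iter_mul_const (hd : IsDeriv d) (A G : Matrix (Fin l) (Fin l) R) (hG : dMat d G = 0)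
    (j : ℕ) : (dMat d)^[j] (A * G) = (dMat d)^[j] A * G := by
  induction j with
  | zero => rfl
  | succ j ih =>
    rw [Function.iterate_succ_apply', Function.iterate_succ_apply', ih, dMat_mul hd, hG]
    simp

lemma iter_fund (hd : IsDeriv d) (N Ψ : Matrix (Fin l) (Fin l) R) (h : dMat d Ψ = N * Ψ)
    (j : ℕ) : (dMat d)^[j] Ψ = pMat d N j * Ψ := by
  induction j with
  | zero => simp [pMat]
  | succ j ih =>
    rw [Function.iterate_succ_apply', ih, dMat_mul hd, h, pMat, add_mul, dMat, mul_assoc, add_comm]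

lemma iter_col (A : Matrix (Fin l) (Fin l) R) (c : Fin l) (j : ℕ) :
    (dVec d)^[j] (fun i => A i c) = fun i => ((dMat d)^[j] A) i c := by
  induction j with
  | zero => rfl
  | succ j ih =>
    rw [Function.iterate_succ_apply', Function.iterate_succ_apply', ih]
    rfl

end

section
variable {K E : Type*} [CommRing K] [CommRing E] (ι : K →+* E) {dE : E → E} {l : ℕ}
  (n : ℕ) (Bc : ℕ → Matrix (Fin l) (Fin l) K)

lemma opQMat_mul_const (hd : IsDeriv dE) (A G : Matrix (Fin l) (Fin l) E)
    (hG : dMat dE G = 0) : opQMat ι dE n Bc (A * G) = opQMat ι dE n Bc A * G := by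
  simp only [opQMat, iter_mul_const hd A G hG, Finset.sum_mul, mul_assoc]

lemma opQ_col (A : Matrix (Fin l) (Fin l) E) (c : Fin l) :
    opQ ι dE n Bc (fun i => A i c) = fun i => opQMat ι dE n Bc A i c := by
  ext i
  simp only [opQ, opQMat, iter_col, Finset.sum_apply, Matrix.sum_apply]
  rfl

lemma opP_col (A0 A1 : Matrix (Fin l) (Fin l) K) (A : Matrix (Fin l) (Fin l) E) (c : Fin l) :
    opP ι dE A0 A1 (fun i => A i c) = fun i => (A0.map ι * A + A1.map ι * dMat dE A) i c := by
  ext i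
  rfl

end

lemma dE_eval {K E : Type*} [CommRing K] [CommRing E] (ι : K →+* E) {dK : K → K} {dE : E → E}
    (hdK : IsDeriv dK) (hdE : IsDeriv dE) (hcomp : ∀ a : K, dE (ι a) = ι (dK a))
    {lam : E} (hlam : dE lam = 0) (p : Polynomial K) :
    dE (eval₂ ι lam p) = eval₂ ι lam (dPoly dK p) := by
  have hpow : ∀ k : ℕ, dE (lam ^ k) = 0 := by
    intro k
    induction k with
    | zero => simpa using d_one hdE
    | succ k ih => rw [pow_succ, hdE.2, ih, hlam]; simp
  rw [eval₂_eq_sum, dPoly, Polynomial.sum, Polynomial.sum, d_sum hdE, eval₂_finset_sum]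
  refine Finset.sum_congr rfl fun k _ => ?_
  rw [hdE.2, hpow, hcomp]
  simp

lemma pMat_map {R S : Type*} [CommRing R] [CommRing S] (φ : R →+* S) (dR : R → R) (dS : S → S)
    (h : ∀ a, dS (φ a) = φ (dR a)) {l : ℕ} (N : Matrix (Fin l) (Fin l) R) (j : ℕ) :
    (pMat dR N j).map φ = pMat dS (N.map φ) j := by
  induction j with
  | zero => simp [pMat, Matrix.map_one]
  | succ j ih =>
    rw [pMat, pMat, ← ih, Matrix.map_add _ (map_add φ), Matrix.map_mul]
    congr 1
    ext a b
    simp [h]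

section
variable {K E : Type*} [Field K] [Field E] (ι : K →+* E) {dK : K → K} {dE : E → E} {l : ℕ}
  (A0 A1 : Matrix (Fin l) (Fin l) K)

lemma Nlam_map (lam : E) :
    (Nlam A0 A1).map (eval₂RingHom ι lam) = NlamE ι lam A0 A1 := by
  ext i j
  simp only [Nlam, NlamE, Matrix.map_apply, Matrix.neg_apply, Matrix.mul_apply, map_neg, map_sum,
    map_mul, Matrix.sub_apply, map_sub, Matrix.smul_apply, Matrix.one_apply, smul_eq_mul]
  simp [apply_ite, -mul_ite]

lemma Mspec_map (hdK : IsDeriv dK) (hdE : IsDeriv dE) (hcomp : ∀ a : K, dE (ι a) = ι (dK a))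
    {lam : E} (hlam : dE lam = 0) (mu : E) (n : ℕ) (Bc : ℕ → Matrix (Fin l) (Fin l) K) :
    (Mspec dK n A0 A1 Bc).map (evalLM ι lam mu) =
      (∑ j ∈ Finset.range (n + 1), (Bc j).map ι * pMat dE (NlamE ι lam A0 A1) j) - mu • 1 := by
  have hp := fun j => pMat_map (eval₂RingHom ι lam) (dPoly dK) dE
    (fun a => dE_eval ι hdK hdE hcomp hlam a) (Nlam A0 A1) j
  simp only [← Nlam_map, ← hp]
  ext a b
  simp only [Mspec, Matrix.map_apply, Matrix.sub_apply, map_sub, Matrix.sum_apply, map_sum,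
    Matrix.mul_apply, map_mul, Matrix.smul_apply, smul_eq_mul, Matrix.one_apply]
  by_cases hab : a = b <;> simp [hab, evalLM]

end

lemma binom_id {R : Type*} [CommRing R] {l : ℕ} (G D : Matrix (Fin l) (Fin l) R) (mu : R)
    (h : D = G - mu • 1) (i : ℕ) :
    mu ^ i • (1 : Matrix (Fin l) (Fin l) R) = G ^ i + ∑ k ∈ Finset.range i,
      ((-1 : R) ^ (i - k) * (i.choose k : R)) • (G ^ k * D ^ (i - k)) := by
  have hc : Commute G (-D) := by
    rw [h, neg_sub]
    exact ((Commute.one_right G).smul_right mu).sub_right (Commute.refl G)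
  have h1 : mu • (1 : Matrix (Fin l) (Fin l) R) = G + -D := by rw [h]; abel
  have h2 : mu ^ i • (1 : Matrix (Fin l) (Fin l) R) = (mu • 1) ^ i := by
    rw [_root_.smul_pow, one_pow]
  rw [h2, h1, hc.add_pow, Finset.sum_range_succ, add_comm]
  congr 1
  · simp
  · refine Finset.sum_congr rfl fun k _ => ?_
    rw [neg_pow, mul_smul, Nat.cast_smul_eq_nsmul, nsmul_eq_mul]
    have : (-1 : Matrix (Fin l) (Fin l) R) ^ (i - k) = ((-1 : R) ^ (i - k)) • 1 := by
      rcases neg_one_pow_eq_or R (i - k) with h | h <;>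
      rcases Nat.even_or_odd (i-k) with h' | h' <;> simp [h'.neg_one_pow]
    rw [this]
    simp only [smul_mul_assoc, one_mul, mul_smul_comm]
    rw [← Nat.cast_comm]

lemma intertwine {R : Type*} [CommRing R] {l : ℕ} {A B P : Matrix (Fin l) (Fin l) R}
    (h : A * P = P * B) (k : ℕ) : A ^ k * P = P * B ^ k := by
  have : SemiconjBy P B A := h.symm
  exact (this.pow_right k).symm

end S12

/-- Lemma 5.4: for every `g(λ,μ) = Σ_{i=0}^p a_i(λ) μ^i` with constant
coefficients, `g(λ,μ)·Ψ = Σ_i a_i(λ)·B̂^i(Ψ) + Θ(g)·Ψ·Δ`, with `Δ = Ψ⁻¹(B̂(Ψ) - μΨ)`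
constant, `det Δ = f(λ,μ)`, and `Θ(g)` an explicit matrix whose entries are evaluations of
polynomials in `K[λ,μ]`. -/
theorem statement12 {K E C₀ : Type*} [Field K] [Field E] [Field C₀] [CharZero K]
    [IsAlgClosed C₀]
    (dK : K → K) (hdK : IsDeriv dK) (dE : E → E) (hdE : IsDeriv dE)
    (ι : K →+* E) (hcomp : ∀ a : K, dE (ι a) = ι (dK a))
    (jC : C₀ →+* K) (hjc : ∀ c, dK (jC c) = 0) (hjsur : ∀ a : K, dK a = 0 → ∃ c, jC c = a)
    (lam mu : E) (hlam : dE lam = 0) (hmu : dE mu = 0)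
    (halg : Function.Injective (evalLM ι lam mu))
    {l : ℕ} (hl : 1 ≤ l)
    (A0 A1 : Matrix (Fin l) (Fin l) K) (hA1 : IsUnit A1.det)
    (n : ℕ) (hn : 1 ≤ n) (Bc : ℕ → Matrix (Fin l) (Fin l) K)
    (hcomm : ∀ ψ : Fin l → E,
      opP ι dE A0 A1 (opQ ι dE n Bc ψ) = opQ ι dE n Bc (opP ι dE A0 A1 ψ))
    (Ψ : Matrix (Fin l) (Fin l) E) (hΨu : IsUnit Ψ.det)
    (hΨ : dMat dE Ψ = NlamE ι lam A0 A1 * Ψ)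
    (g : Polynomial (Polynomial C₀)) :
    ∃ Θ Δ : Matrix (Fin l) (Fin l) E,
      Δ = Ψ⁻¹ * (opQMat ι dE n Bc Ψ - mu • Ψ)
      ∧ (∀ i j, dE (Δ i j) = 0)
      ∧ Δ.det = evalLM ι lam mu (fSpec dK n A0 A1 Bc)
      ∧ Θ = ∑ i ∈ Finset.Icc 1 g.natDegree,
          Polynomial.eval₂ (ι.comp jC) lam (g.coeff i) •
            ∑ k ∈ Finset.range i,
              ((-1 : E) ^ (i - k) * (i.choose k : E)) •
                (((Mspec dK n A0 A1 Bc).map (evalLM ι lam mu) + mu • 1) ^ k *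
                  ((Mspec dK n A0 A1 Bc).map (evalLM ι lam mu)) ^ (i - 1 - k))
      ∧ (∀ i j : Fin l, ∃ θ : Polynomial (Polynomial K), Θ i j = evalLM ι lam mu θ)
      ∧ evalLM (ι.comp jC) lam mu g • Ψ
          = (∑ i ∈ Finset.range (g.natDegree + 1),
              Polynomial.eval₂ (ι.comp jC) lam (g.coeff i) • (opQMat ι dE n Bc)^[i] Ψ)
            + Θ * Ψ * Δ := by
  have hQ : opQMat ι dE n Bc Ψ =
      (∑ j ∈ Finset.range (n + 1), (Bc j).map ι * pMat dE (NlamE ι lam A0 A1) j) * Ψ := by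
    simp only [opQMat, S12.iter_fund hdE _ _ hΨ, Finset.sum_mul, mul_assoc]
  have hM := S12.Mspec_map ι A0 A1 hdK hdE hcomp hlam mu n Bc
  set M := (Mspec dK n A0 A1 Bc).map (evalLM ι lam mu) with hMdef
  have hMl : (M + mu • 1) * Ψ = opQMat ι dE n Bc Ψ := by rw [hM, hQ, sub_add_cancel]
  set Φ := opQMat ι dE n Bc Ψ with hΦ
  have hA : A1.map ι * (A1⁻¹).map ι = 1 := by
    rw [← Matrix.map_mul, Matrix.mul_nonsing_inv _ hA1, Matrix.map_one _ (map_zero ι) (map_one ι)]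
  have hA' : (A1⁻¹).map ι * A1.map ι = 1 := by
    rw [← Matrix.map_mul, Matrix.nonsing_inv_mul _ hA1, Matrix.map_one _ (map_zero ι) (map_one ι)]
  have hPΨ : A0.map ι * Ψ + A1.map ι * dMat dE Ψ = Ψ * (lam • 1) := by
    rw [hΨ, NlamE, neg_mul, mul_neg, mul_assoc, ← mul_assoc (A1.map ι), hA, one_mul, sub_mul]
    simp
  have hlc : dMat dE (lam • (1 : Matrix (Fin l) (Fin l) E)) = 0 := S12.dMat_scalar hdE hlam
  have hPΦ : A0.map ι * Φ + A1.map ι * dMat dE Φ = Φ * (lam • 1) := by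
    rw [hΦ, ← S12.opQMat_mul_const ι n Bc hdE _ _ hlc, ← hPΨ]
    ext i c
    have h := congrFun (hcomm (fun i => Ψ i c)) i
    rw [S12.opQ_col, S12.opP_col, S12.opP_col, S12.opQ_col] at h
    exact h
  have hΦ' : dMat dE Φ = NlamE ι lam A0 A1 * Φ := by
    have h1 : A1.map ι * dMat dE Φ = -((A0.map ι - lam • 1) * Φ) := by
      rw [sub_mul, neg_sub, eq_sub_iff_add_eq, add_comm, hPΦ]
      simp
    calc dMat dE Φ = (A1⁻¹).map ι * (A1.map ι * dMat dE Φ) := by rw [← mul_assoc, hA', one_mul]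
      _ = _ := by rw [h1, NlamE, mul_neg, neg_mul, mul_assoc]
  set G := Ψ⁻¹ * Φ with hG
  have hΨG : Ψ * G = Φ := by rw [hG, ← mul_assoc, Matrix.mul_nonsing_inv _ hΨu, one_mul]
  have hGc : dMat dE G = 0 := by
    have h := S12.dMat_mul hdE Ψ G
    rw [hΨG, hΦ', hΨ, mul_assoc, hΨG] at h
    have h0 : Ψ * dMat dE G = 0 := by simpa using h
    calc dMat dE G = Ψ⁻¹ * (Ψ * dMat dE G) := by
          rw [← mul_assoc, Matrix.nonsing_inv_mul _ hΨu, one_mul]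
      _ = 0 := by rw [h0, mul_zero]
  set Δ := Ψ⁻¹ * (Φ - mu • Ψ) with hΔ
  have hΔG : Δ = G - mu • 1 := by
    rw [hΔ, mul_sub, mul_smul_comm, Matrix.nonsing_inv_mul _ hΨu]
  have hMG : (M + mu • 1) * Ψ = Ψ * G := by rw [hMl, hΨG]
  have hMΔ : M * Ψ = Ψ * Δ := by
    rw [hΔG, mul_sub, ← hMG, add_mul]
    simp
  have hiter : ∀ i, (opQMat ι dE n Bc)^[i] Ψ = Ψ * G ^ i := by
    have hGi : ∀ i, dMat dE (G ^ i) = 0 := by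
      intro i
      induction i with
      | zero => simpa using S12.dMat_scalar (l := l) hdE (S12.d_one hdE)
      | succ i ih => rw [pow_succ, S12.dMat_mul hdE, ih, hGc]; simp
    intro i
    induction i with
    | zero => simp
    | succ i ih =>
      rw [Function.iterate_succ_apply', ih, S12.opQMat_mul_const ι n Bc hdE _ _ (hGi i), ← hΦ,
        ← hΨG, pow_succ', mul_assoc]
  refine ⟨_, Δ, rfl, ?_, ?_, rfl, ?_, ?_⟩
  · intro i j
    have h1 : dMat dE G = dMat dE Δ + dMat dE (mu • 1) := by
      rw [← S12.dMat_add hdE, hΔG, sub_add_cancel]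
    rw [hGc, S12.dMat_scalar hdE hmu, add_zero] at h1
    exact (congrFun (congrFun h1 i) j).symm
  · have h1 : (evalLM ι lam mu) (fSpec dK n A0 A1 Bc) = M.det := by
      rw [fSpec, RingHom.map_det]; rfl
    have h2 := congrArg Matrix.det hMΔ
    rw [Matrix.det_mul, Matrix.det_mul, mul_comm] at h2
    rw [h1]
    exact (hΨu.mul_left_cancel h2).symm
  · have hs : ∀ (p : Polynomial (Polynomial K)) (X : Matrix (Fin l) (Fin l) E),
        X ∈ (evalLM ι lam mu).mapMatrix.range → 
        evalLM ι lam mu p • X ∈ ((evalLM ι lam mu).mapMatrix (m := Fin l)).range := by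
      rintro p _ ⟨Y, rfl⟩
      refine ⟨p • Y, ?_⟩
      ext a b
      simp
    have hMr : M ∈ ((evalLM ι lam mu).mapMatrix (m := Fin l)).range := ⟨_, rfl⟩
    have key : (∑ i ∈ Finset.Icc 1 g.natDegree,
          Polynomial.eval₂ (ι.comp jC) lam (g.coeff i) •
            ∑ k ∈ Finset.range i,
              ((-1 : E) ^ (i - k) * (i.choose k : E)) •
                ((M + mu • 1) ^ k * M ^ (i - 1 - k)))
          ∈ ((evalLM ι lam mu).mapMatrix (m := Fin l)).range := by
      refine sum_mem fun i _ => ?_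
      have e1 : Polynomial.eval₂ (ι.comp jC) lam (g.coeff i) =
          evalLM ι lam mu (C ((g.coeff i).map jC)) := by
        simp [evalLM, eval₂_map]
      rw [e1]
      refine hs _ _ (sum_mem fun k _ => ?_)
      have e2 : ((-1 : E) ^ (i - k) * (i.choose k : E)) =
          evalLM ι lam mu ((-1) ^ (i - k) * (i.choose k : Polynomial (Polynomial K))) := by
        simp
      rw [e2]
      refine hs _ _ (mul_mem (pow_mem (add_mem hMr ?_) _) (pow_mem hMr _))
      have e3 : mu = evalLM ι lam mu X := by simp [evalLM]
      have := hs X 1 (one_mem _)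
      rwa [← e3] at this
    obtain ⟨Y, hY⟩ := key
    intro i j
    refine ⟨Y i j, ?_⟩
    rw [← hY]
    rfl
  · have hstep : ∀ i, mu ^ i • Ψ = (opQMat ι dE n Bc)^[i] Ψ + (∑ k ∈ Finset.range i,
              ((-1 : E) ^ (i - k) * (i.choose k : E)) •
                ((M + mu • 1) ^ k * M ^ (i - 1 - k))) * Ψ * Δ := by
      intro i
      have h := congrArg (fun X => Ψ * X) (S12.binom_id G Δ mu hΔG i)
      simp only [mul_smul_comm, mul_one, mul_add, Finset.mul_sum] at h
      rw [h, hiter, Finset.sum_mul, Finset.sum_mul]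
      congr 1
      refine Finset.sum_congr rfl fun k hk => ?_
      have hk' : i - k = (i - 1 - k) + 1 := by have := Finset.mem_range.1 hk; omega
      rw [smul_mul_assoc, smul_mul_assoc, mul_assoc (_ ^ k), S12.intertwine hMΔ,
        ← mul_assoc (_ ^ k), S12.intertwine hMG, mul_assoc, mul_assoc, ← pow_succ, ← hk']
    have hg : evalLM (ι.comp jC) lam mu g = ∑ i ∈ Finset.range (g.natDegree + 1),
        Polynomial.eval₂ (ι.comp jC) lam (g.coeff i) * mu ^ i := by
      simp [evalLM, eval₂_eq_sum_range]
    have hI : (∑ i ∈ Finset.Icc 1 g.natDegree,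
          Polynomial.eval₂ (ι.comp jC) lam (g.coeff i) •
            ∑ k ∈ Finset.range i,
              ((-1 : E) ^ (i - k) * (i.choose k : E)) •
                ((M + mu • 1) ^ k * M ^ (i - 1 - k))) =
        ∑ i ∈ Finset.range (g.natDegree + 1),
          Polynomial.eval₂ (ι.comp jC) lam (g.coeff i) •
            ∑ k ∈ Finset.range i,
              ((-1 : E) ^ (i - k) * (i.choose k : E)) •
                ((M + mu • 1) ^ k * M ^ (i - 1 - k)) := by
      refine Finset.sum_subset ?_ ?_
      · intro i hi
        simp only [Finset.mem_Icc, Finset.mem_range] at *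
        omega
      · intro i hi hi'
        have : i = 0 := by
          simp only [Finset.mem_Icc, Finset.mem_range] at *
          omega
        subst this
        simp
    rw [hI, hg, Finset.sum_smul, Finset.sum_mul, Finset.sum_mul, ← Finset.sum_add_distrib]
    refine Finset.sum_congr rfl fun i _ => ?_
    rw [mul_smul, hstep i, smul_add, smul_mul_assoc, smul_mul_assoc]
end

section
/- (Theorem 5.5.) Assume the hypotheses: E is a differential field extension of K with differential constants λ, μ algebraically independent over K, a fundamental matrix Ψ ∈ M_ℓ(E) for L − λ exists, and L̂ ∘ B̂ = B̂ ∘ L̂ on E^ℓ (so that f(λ,μ) = det M(L−λ, B−μ) ∈ C[λ,μ]). Let f_red = h_1·…·h_s be the product of the distinct irreducible factors of f in C[λ,μ]. Then BC ⊆ (f_red), i.e., every polynomial g ∈ C[λ,μ] with g(L̂,B̂) = 0 on E^ℓ is divisible by f_red. If moreover f ∈ BC (i.e., f(L̂,B̂) = 0 on E^ℓ), then (f) ⊆ BC ⊆ (f_red). -/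
open Matrix Polynomial Finset

section Helpers

theorem neg_one_cancel {R : Type*} [CommRing R] (l : ℕ) (x : R) :
    (-1) ^ l * (-1) ^ l * x = x := by
  rw [← mul_pow]; simp

theorem h_dvd_aux {R A : Type*} [CommRing R] [Ring A] [Algebra R A] (a b : A) (hab : Commute a b)
    (g : Polynomial R) : ∃ Q, Polynomial.aeval a g - Polynomial.aeval b g = (a - b) * Q := by
  change (a - b) ∣ _
  rw [Polynomial.aeval_eq_sum_range, Polynomial.aeval_eq_sum_range, ← Finset.sum_sub_distrib]
  refine Finset.dvd_sum fun i _ => ?_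
  rw [← smul_sub]
  obtain ⟨Q, hQ⟩ := hab.sub_dvd_pow_sub_pow i
  exact ⟨g.coeff i • Q, by rw [hQ, mul_smul_comm]⟩

theorem charpoly_dvd_pow {E : Type*} [CommRing E] {l : ℕ} (T : Matrix (Fin l) (Fin l) E)
    (g : Polynomial E) (hg : Polynomial.aeval T g = 0) : T.charpoly ∣ g ^ l := by
  have hab : Commute (Matrix.scalar (Fin l) (Polynomial.X : Polynomial E))
      (T.map (Polynomial.C : E →+* Polynomial E)) :=
    Matrix.scalar_commute _ (fun r => Commute.all _ _) _
  obtain ⟨Q, hQ⟩ := h_dvd_aux (R := E) _ _ hab g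
  have h2 : Polynomial.aeval (T.map (Polynomial.C : E →+* Polynomial E)) g = 0 := by
    have := Polynomial.aeval_algHom_apply
      ((Algebra.ofId E (Polynomial E)).mapMatrix (m := Fin l)) T g
    rw [hg, map_zero] at this
    exact this
  have h1 : Polynomial.aeval (Matrix.scalar (Fin l) (Polynomial.X : Polynomial E)) g
      = Matrix.scalar (Fin l) g := by
    have := Polynomial.aeval_algHom_apply
      (Matrix.scalarAlgHom (Fin l) E (α := Polynomial E)) Polynomial.X g
    simpa using this
  rw [h1, h2, sub_zero] at hQ
  have := congrArg Matrix.det hQ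
  rw [Matrix.det_mul] at this
  refine ⟨Q.det, ?_⟩
  rw [Matrix.charpoly, Matrix.charmatrix]
  rw [show (Polynomial.C : E →+* Polynomial E).mapMatrix T = T.map Polynomial.C from rfl]
  rw [← this]
  simp

variable {E : Type*} [CommRing E] {d : E → E} (hd : IsDeriv d) {l : ℕ}

theorem d_zero (hd : IsDeriv d) : d 0 = 0 := by
  have := hd.1 0 0
  simpa using this

theorem d_one (hd : IsDeriv d) : d 1 = 0 := by
  have := hd.2 1 1
  simpa using this

theorem d_sum (hd : IsDeriv d) {α : Type*} (s : Finset α) (f : α → E) :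
    d (∑ i ∈ s, f i) = ∑ i ∈ s, d (f i) :=
  map_sum (AddMonoidHom.mk' d hd.1) f s

theorem d_pow_const (hd : IsDeriv d) {a : E} (ha : d a = 0) (k : ℕ) : d (a ^ k) = 0 := by
  induction k with
  | zero => simpa using d_one hd
  | succ k ih => rw [pow_succ, hd.2, ih, ha]; simp

theorem dVec_mulVec (hd : IsDeriv d) (A : Matrix (Fin l) (Fin l) E) (v : Fin l → E) :
    dVec d (A.mulVec v) = (A.map d).mulVec v + A.mulVec (dVec d v) := by
  ext i
  simp [dVec, Matrix.mulVec, dotProduct, d_sum hd, hd.2, Finset.sum_add_distrib]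

theorem dVec_add (hd : IsDeriv d) (v w : Fin l → E) :
    dVec d (v + w) = dVec d v + dVec d w := by
  ext i; simp [dVec, hd.1]

theorem dVec_smul (hd : IsDeriv d) {c : E} (hc : d c = 0) (v : Fin l → E) :
    dVec d (c • v) = c • dVec d v := by
  ext i; simp [dVec, hd.2, hc]

theorem dVec_iter_add (hd : IsDeriv d) (j : ℕ) (v w : Fin l → E) :
    (dVec d)^[j] (v + w) = (dVec d)^[j] v + (dVec d)^[j] w := by
  induction j with
  | zero => rfl
  | succ j ih => simp only [Function.iterate_succ_apply', ih, dVec_add hd]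

theorem dVec_iter_smul (hd : IsDeriv d) {c : E} (hc : d c = 0) (j : ℕ) (v : Fin l → E) :
    (dVec d)^[j] (c • v) = c • (dVec d)^[j] v := by
  induction j with
  | zero => rfl
  | succ j ih => simp only [Function.iterate_succ_apply', ih, dVec_smul hd hc]

theorem dMul (hd : IsDeriv d) (A B : Matrix (Fin l) (Fin l) E) :
    (A * B).map d = A.map d * B + A * B.map d := by
  ext i j
  simp [Matrix.mul_apply, d_sum hd, hd.2, Finset.sum_add_distrib]

theorem dVec_iter_fund (hd : IsDeriv d) (N Ψ : Matrix (Fin l) (Fin l) E)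
    (hΨ : dMat d Ψ = N * Ψ) (v : Fin l → E) (hv : dVec d v = 0) (j : ℕ) :
    (dVec d)^[j] (Ψ.mulVec v) = (pMat d N j * Ψ).mulVec v := by
  induction j with
  | zero => simp [pMat]
  | succ j ih =>
    rw [Function.iterate_succ_apply', ih, dVec_mulVec hd, hv, dMul hd]
    have : Ψ.map d = N * Ψ := hΨ
    rw [this, pMat, add_mul, mul_assoc, Matrix.mulVec_zero, add_zero,
      add_comm (pMat d N j * (N * Ψ))]

variable {K : Type*} [Field K]

theorem opP_add (hd : IsDeriv d) (ι : K →+* E) (A0 A1 : Matrix (Fin l) (Fin l) K)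
    (v w : Fin l → E) : opP ι d A0 A1 (v + w) = opP ι d A0 A1 v + opP ι d A0 A1 w := by
  simp only [opP, dVec_add hd, Matrix.mulVec_add]; abel

theorem opP_smul (hd : IsDeriv d) (ι : K →+* E) (A0 A1 : Matrix (Fin l) (Fin l) K)
    {c : E} (hc : d c = 0)
    (v : Fin l → E) : opP ι d A0 A1 (c • v) = c • opP ι d A0 A1 v := by
  simp only [opP, dVec_smul hd hc, Matrix.mulVec_smul, smul_add]

theorem opQ_add (hd : IsDeriv d) (ι : K →+* E) (n : ℕ) (B : ℕ → Matrix (Fin l) (Fin l) K)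
    (v w : Fin l → E) : opQ ι d n B (v + w) = opQ ι d n B v + opQ ι d n B w := by
  simp only [opQ, dVec_iter_add hd, Matrix.mulVec_add, Finset.sum_add_distrib]

theorem opQ_smul (hd : IsDeriv d) (ι : K →+* E) (n : ℕ) (B : ℕ → Matrix (Fin l) (Fin l) K)
    {c : E} (hc : d c = 0)
    (v : Fin l → E) : opQ ι d n B (c • v) = c • opQ ι d n B v := by
  simp only [opQ, dVec_iter_smul hd hc, Matrix.mulVec_smul, Finset.smul_sum]

/-- matrix of B on the solution space -/
noncomputable def ME (ι : K →+* E) (d : E → E) (n : ℕ) (B : ℕ → Matrix (Fin l) (Fin l) K)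
    (N : Matrix (Fin l) (Fin l) E) : Matrix (Fin l) (Fin l) E :=
  ∑ j ∈ Finset.range (n + 1), (B j).map ι * pMat d N j

theorem opQ_fund (hd : IsDeriv d) (ι : K →+* E) (n : ℕ) (B : ℕ → Matrix (Fin l) (Fin l) K)
    (N Ψ : Matrix (Fin l) (Fin l) E)
    (hΨ : dMat d Ψ = N * Ψ) (v : Fin l → E) (hv : dVec d v = 0) :
    opQ ι d n B (Ψ.mulVec v) = (ME ι d n B N * Ψ).mulVec v := by
  simp only [opQ, ME, dVec_iter_fund hd N Ψ hΨ v hv, Finset.sum_mul, Matrix.sum_mulVec,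
    Matrix.mulVec_mulVec, mul_assoc]

theorem A1_cancel (ι : K →+* E) (A1 : Matrix (Fin l) (Fin l) K) (hA1 : IsUnit A1.det) :
    A1.map ι * (A1⁻¹).map ι = 1 ∧ (A1⁻¹).map ι * A1.map ι = 1 := by
  rw [← Matrix.map_mul, ← Matrix.map_mul, Matrix.mul_nonsing_inv _ hA1,
    Matrix.nonsing_inv_mul _ hA1]
  simp

theorem opP_iff (ι : K →+* E) (A0 A1 : Matrix (Fin l) (Fin l) K)
    (hA1 : IsUnit A1.det) (lam : E) (w : Fin l → E) :
    opP ι d A0 A1 w = lam • w ↔ dVec d w = (NlamE ι lam A0 A1).mulVec w := by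
  obtain ⟨h1, h2⟩ := A1_cancel ι A1 hA1
  have e : (NlamE ι lam A0 A1).mulVec w
      = (A1⁻¹.map ι).mulVec (lam • w - (A0.map ι).mulVec w) := by
    rw [NlamE, Matrix.neg_mulVec, ← Matrix.mulVec_mulVec, ← Matrix.mulVec_neg,
      Matrix.sub_mulVec, neg_sub, Matrix.smul_mulVec, Matrix.one_mulVec]
  rw [e, opP]
  constructor
  · intro h
    rw [← h, add_sub_cancel_left, Matrix.mulVec_mulVec, h2, Matrix.one_mulVec]
  · intro h
    rw [h, Matrix.mulVec_mulVec, h1, Matrix.one_mulVec, add_sub_cancel]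

theorem pMat_map {R S : Type*} [CommRing R] [CommRing S] (φ : R →+* S) (d : R → R) (d' : S → S)
    (h : ∀ a, d' (φ a) = φ (d a)) (N : Matrix (Fin l) (Fin l) R) (j : ℕ) :
    (pMat d N j).map φ = pMat d' (N.map φ) j := by
  induction j with
  | zero => simp [pMat]
  | succ j ih =>
    rw [pMat, pMat, ← ih, Matrix.map_add _ (map_add φ), Matrix.map_mul]
    congr 1
    ext a b
    simp [h]

theorem eval_dPoly (hd : IsDeriv d) (dK : K → K) (ι : K →+* E)
    (hcomp : ∀ a, d (ι a) = ι (dK a))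
    (lam : E) (hlam : d lam = 0) (p : Polynomial K) :
    d (Polynomial.eval₂RingHom ι lam p) = Polynomial.eval₂RingHom ι lam (dPoly dK p) := by
  rw [dPoly, Polynomial.sum_def, map_sum, Polynomial.coe_eval₂RingHom, Polynomial.eval₂_def,
    Polynomial.sum_def, d_sum hd]
  refine Finset.sum_congr rfl fun k _ => ?_
  simp [hd.2, d_pow_const hd hlam, hcomp]

theorem applyPoly_eq {C₀ : Type*} [CommRing C₀] (ιc : C₀ →+* E)
    (Lh Bh : AddMonoid.End (Fin l → E)) (hL : ∀ c v, Lh (ιc c • v) = ιc c • Lh v)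
    (hB : ∀ c v, Bh (ιc c • v) = ιc c • Bh v) (hLB : Commute Lh Bh) :
    ∃ Φ : Polynomial (Polynomial C₀) →+* AddMonoid.End (Fin l → E),
      ∀ g ψ, applyPoly ιc Lh Bh g ψ = Φ g ψ := by
  let σ : C₀ →+* AddMonoid.End (Fin l → E) := (Module.toAddMonoidEnd E (Fin l → E)).comp ιc
  have hσ : ∀ c v, σ c v = ιc c • v := fun c v => rfl
  have c1 : ∀ c, Commute (σ c) Lh := fun c => by
    ext1 v
    simp [hσ, hL]
  have c2 : ∀ c, Commute (σ c) Bh := fun c => by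
    ext1 v
    simp [hσ, hB]
  let φ := Polynomial.eval₂RingHom' σ Lh c1
  have c3 : ∀ p, Commute (φ p) Bh := fun p => by
    change Commute (Polynomial.eval₂ σ Lh p) Bh
    rw [Polynomial.eval₂_eq_sum_range]
    exact Commute.sum_left _ _ _ fun i _ => (c2 _).mul_left (hLB.pow_left _)
  refine ⟨Polynomial.eval₂RingHom' φ Bh c3, fun g ψ => ?_⟩
  change _ = Polynomial.eval₂ φ Bh g ψ
  have hφ : ∀ p, φ p = Polynomial.eval₂ σ Lh p := fun p => rfl
  have hs : ∀ (S : Finset ℕ) (f : ℕ → AddMonoid.End (Fin l → E)) (w : Fin l → E),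
      (∑ i ∈ S, f i) w = ∑ i ∈ S, f i w := fun S f w => AddMonoidHom.finsetSum_apply f S w
  rw [Polynomial.eval₂_eq_sum_range, applyPoly, hs]
  refine Finset.sum_congr rfl fun i _ => ?_
  rw [hφ, Polynomial.eval₂_eq_sum_range, Finset.sum_mul, hs]
  refine Finset.sum_congr rfl fun k _ => ?_
  simp [hσ, AddMonoid.End.coe_pow]

end Helpers

section Main

variable {K E : Type*} [Field K] [Field E] {l : ℕ}

theorem T_const {d : E → E} (hd : IsDeriv d) (ι : K →+* E) (lam : E) (hlam : d lam = 0)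
    (A0 A1 : Matrix (Fin l) (Fin l) K) (hA1 : IsUnit A1.det)
    (n : ℕ) (Bc : ℕ → Matrix (Fin l) (Fin l) K)
    (hcomm : ∀ ψ : Fin l → E,
      opP ι d A0 A1 (opQ ι d n Bc ψ) = opQ ι d n Bc (opP ι d A0 A1 ψ))
    (Ψ T : Matrix (Fin l) (Fin l) E) (hΨu : IsUnit Ψ.det)
    (hΨ : dMat d Ψ = NlamE ι lam A0 A1 * Ψ)
    (hT : ME ι d n Bc (NlamE ι lam A0 A1) * Ψ = Ψ * T) : T.map d = 0 := by
  have key : ∀ v, dVec d v = 0 → opP ι d A0 A1 (Ψ.mulVec v) = lam • Ψ.mulVec v := by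
    intro v hv
    rw [opP_iff ι A0 A1 hA1, dVec_mulVec hd, hv, Matrix.mulVec_zero, add_zero,
      Matrix.mulVec_mulVec, ← hΨ]
    rfl
  have hz : Ψ * T.map d = 0 := by
    apply Matrix.ext_of_mulVec_single
    intro i
    have hv : dVec d (Pi.single i (1 : E)) = 0 := by
      ext j
      by_cases hj : j = i
      · subst hj; simp [dVec, d_one hd]
      · simp [dVec, hj, d_zero hd]
    generalize (Pi.single i (1 : E) : Fin l → E) = v at hv
    have h1 : opP ι d A0 A1 ((Ψ * T).mulVec v) = lam • (Ψ * T).mulVec v := by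
      rw [← hT, ← opQ_fund hd ι n Bc _ Ψ hΨ v hv, hcomm, key v hv, opQ_smul hd ι n Bc hlam]
    rw [opP_iff ι A0 A1 hA1, dVec_mulVec hd, hv, Matrix.mulVec_zero, add_zero, dMul hd,
      show Ψ.map d = _ from hΨ, Matrix.add_mulVec, Matrix.mulVec_mulVec, mul_assoc] at h1
    simpa using h1
  have := congrArg (Ψ⁻¹ * ·) hz
  simpa [← mul_assoc, Matrix.nonsing_inv_mul _ hΨu] using this

theorem apply_fund {C₀ : Type*} [Field C₀] (ιc : C₀ →+* E) {d : E → E} (hd : IsDeriv d)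
    (ι : K →+* E) (lam : E) (hlam : d lam = 0)
    (A0 A1 : Matrix (Fin l) (Fin l) K) (hA1 : IsUnit A1.det)
    (n : ℕ) (Bc : ℕ → Matrix (Fin l) (Fin l) K)
    (Ψ T : Matrix (Fin l) (Fin l) E)
    (hΨ : dMat d Ψ = NlamE ι lam A0 A1 * Ψ)
    (hT : ME ι d n Bc (NlamE ι lam A0 A1) * Ψ = Ψ * T) (hTd : T.map d = 0)
    (v : Fin l → E) (hv : dVec d v = 0) (g : Polynomial (Polynomial C₀)) :
    applyPoly ιc (opP ι d A0 A1) (opQ ι d n Bc) g (Ψ.mulVec v)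
      = (Ψ * Polynomial.aeval T (g.map (Polynomial.eval₂RingHom ιc lam))).mulVec v := by
  have key : ∀ v, dVec d v = 0 → opP ι d A0 A1 (Ψ.mulVec v) = lam • Ψ.mulVec v := by
    intro v hv
    rw [opP_iff ι A0 A1 hA1, dVec_mulVec hd, hv, Matrix.mulVec_zero, add_zero,
      Matrix.mulVec_mulVec, ← hΨ]
    rfl
  have hTi : ∀ i, dVec d ((T ^ i).mulVec v) = 0 := by
    intro i
    induction i with
    | zero => simpa using hv
    | succ i ih =>
      rw [pow_succ', ← Matrix.mulVec_mulVec, dVec_mulVec hd, ih, hTd]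
      simp
  have hBi : ∀ i, (opQ ι d n Bc)^[i] (Ψ.mulVec v) = Ψ.mulVec ((T ^ i).mulVec v) := by
    intro i
    induction i with
    | zero => simp
    | succ i ih =>
      rw [Function.iterate_succ_apply', ih, opQ_fund hd ι n Bc _ Ψ hΨ _ (hTi i), hT, pow_succ']
      simp [Matrix.mulVec_mulVec, mul_assoc]
  have hLk : ∀ k i, (opP ι d A0 A1)^[k] (Ψ.mulVec ((T ^ i).mulVec v))
      = lam ^ k • Ψ.mulVec ((T ^ i).mulVec v) := by
    intro k i
    induction k with
    | zero => simp
    | succ k ih =>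
      rw [Function.iterate_succ_apply', ih, opP_smul hd ι A0 A1 (d_pow_const hd hlam k),
        key _ (hTi i), smul_smul, pow_succ]
  rw [Polynomial.aeval_def, Polynomial.eval₂_map, Polynomial.eval₂_eq_sum_range, applyPoly,
    Finset.mul_sum, Matrix.sum_mulVec]
  refine Finset.sum_congr rfl fun i _ => ?_
  simp only [hBi, hLk, smul_smul]
  rw [← Finset.sum_smul, RingHom.comp_apply, Polynomial.coe_eval₂RingHom,
    ← Polynomial.eval₂_eq_sum_range, ← Algebra.smul_def, mul_smul_comm, Matrix.smul_mulVec,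
    Matrix.mulVec_mulVec]

/-- matrix over K[X] -/
noncomputable def M0 (dK : K → K) (n : ℕ) (A0 A1 : Matrix (Fin l) (Fin l) K)
    (Bc : ℕ → Matrix (Fin l) (Fin l) K) : Matrix (Fin l) (Fin l) (Polynomial K) :=
  ∑ j ∈ Finset.range (n + 1), (Bc j).map (Polynomial.C : K →+* Polynomial K) *
    pMat (dPoly dK) (Nlam A0 A1) j

theorem fSpec_eq (dK : K → K) (n : ℕ) (A0 A1 : Matrix (Fin l) (Fin l) K)
    (Bc : ℕ → Matrix (Fin l) (Fin l) K) :
    fSpec dK n A0 A1 Bc = (-1) ^ l * (M0 dK n A0 A1 Bc).charpoly := by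
  rw [Matrix.charpoly, fSpec]
  have : Mspec dK n A0 A1 Bc = - (M0 dK n A0 A1 Bc).charmatrix := by
    rw [Matrix.charmatrix, neg_sub, Mspec, M0, map_sum]
    congr 1
    · refine Finset.sum_congr rfl fun j _ => ?_
      rw [map_mul]
      rfl
    · exact Matrix.smul_one_eq_diagonal _
  rw [this, Matrix.det_neg, Fintype.card_fin]

theorem M0_map {d : E → E} (hd : IsDeriv d) (dK : K → K) (ι : K →+* E)
    (hcomp : ∀ a, d (ι a) = ι (dK a)) (lam : E) (hlam : d lam = 0)
    (n : ℕ) (A0 A1 : Matrix (Fin l) (Fin l) K)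
    (Bc : ℕ → Matrix (Fin l) (Fin l) K) :
    (M0 dK n A0 A1 Bc).map (Polynomial.eval₂RingHom ι lam)
      = ME ι d n Bc (NlamE ι lam A0 A1) := by
  have hC : ∀ B : Matrix (Fin l) (Fin l) K,
      (B.map (Polynomial.C : K →+* Polynomial K)).map (Polynomial.eval₂RingHom ι lam)
        = B.map ι := by
    intro B; ext i j; simp
  have hN : (Nlam A0 A1).map (Polynomial.eval₂RingHom ι lam) = NlamE ι lam A0 A1 := by
    change (Polynomial.eval₂RingHom ι lam).mapMatrix _ = _
    rw [Nlam, NlamE, map_neg, map_mul, map_sub]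
    simp only [RingHom.mapMatrix_apply]
    rw [hC, hC]
    congr 3
    ext i j
    by_cases h : i = j <;> simp [h, Matrix.one_apply]
  change (Polynomial.eval₂RingHom ι lam).mapMatrix _ = _
  rw [M0, map_sum, ME]
  refine Finset.sum_congr rfl fun j _ => ?_
  rw [map_mul]
  simp only [RingHom.mapMatrix_apply]
  rw [hC, pMat_map _ _ d (eval_dPoly hd dK ι hcomp lam hlam), hN]

end Main

/-- Theorem 5.5: the Burchnall–Chaundy ideal satisfies `BC ⊆ (f_red)`,
and if `f ∈ BC` then `(f) ⊆ BC ⊆ (f_red)`, where `f_red = h₁⋯h_s` is the product of the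
distinct irreducible factors of `f` in `C[λ,μ]`. -/
theorem statement13 {K E C₀ : Type*} [Field K] [Field E] [Field C₀] [CharZero K]
    [IsAlgClosed C₀]
    (dK : K → K) (hdK : IsDeriv dK) (dE : E → E) (hdE : IsDeriv dE)
    (ι : K →+* E) (hcomp : ∀ a : K, dE (ι a) = ι (dK a))
    (jC : C₀ →+* K) (hjc : ∀ c, dK (jC c) = 0) (hjsur : ∀ a : K, dK a = 0 → ∃ c, jC c = a)
    (lam mu : E) (hlam : dE lam = 0) (hmu : dE mu = 0)
    (halg : Function.Injective (evalLM ι lam mu))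
    {l : ℕ} (hl : 1 ≤ l)
    (A0 A1 : Matrix (Fin l) (Fin l) K) (hA1 : IsUnit A1.det)
    (n : ℕ) (hn : 1 ≤ n) (Bc : ℕ → Matrix (Fin l) (Fin l) K)
    (hcomm : ∀ ψ : Fin l → E,
      opP ι dE A0 A1 (opQ ι dE n Bc ψ) = opQ ι dE n Bc (opP ι dE A0 A1 ψ))
    (Ψ : Matrix (Fin l) (Fin l) E) (hΨu : IsUnit Ψ.det)
    (hΨ : dMat dE Ψ = NlamE ι lam A0 A1 * Ψ)
    (fC : Polynomial (Polynomial C₀))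
    (hfC : fC.map (Polynomial.mapRingHom jC) = fSpec dK n A0 A1 Bc)
    (s : ℕ) (h : Fin s → Polynomial (Polynomial C₀))
    (hirr : ∀ i, Irreducible (h i))
    (hna : ∀ i j, i ≠ j → ¬Associated (h i) (h j))
    (hdvd : ∀ i, h i ∣ fC)
    (hcover : ∀ p : Polynomial (Polynomial C₀), Irreducible p → p ∣ fC →
      ∃ i, Associated p (h i)) :
    (∀ g : Polynomial (Polynomial C₀),
      (∀ ψ, applyPoly (ι.comp jC) (opP ι dE A0 A1) (opQ ι dE n Bc) g ψ = 0) →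
      (∏ i, h i) ∣ g)
    ∧ ((∀ ψ, applyPoly (ι.comp jC) (opP ι dE A0 A1) (opQ ι dE n Bc) fC ψ = 0) →
        ∀ g : Polynomial (Polynomial C₀), fC ∣ g →
          ∀ ψ, applyPoly (ι.comp jC) (opP ι dE A0 A1) (opQ ι dE n Bc) g ψ = 0) := by
  have hιc : ∀ c, dE ((ι.comp jC) c) = 0 := fun c => by
    rw [RingHom.comp_apply, hcomp, hjc, map_zero]
  refine ⟨fun g hg => ?_, ?_⟩
  · set N := NlamE ι lam A0 A1 with hN
    set M := ME ι dE n Bc N with hM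
    set T := Ψ⁻¹ * M * Ψ with hTdef
    have hT : M * Ψ = Ψ * T := by
      rw [hTdef, ← mul_assoc, ← mul_assoc, Matrix.mul_nonsing_inv _ hΨu, one_mul]
    have hTd := T_const hdE ι lam hlam A0 A1 hA1 n Bc hcomm Ψ T hΨu hΨ hT
    set θ : Polynomial C₀ →+* E := Polynomial.eval₂RingHom (ι.comp jC) lam with hθ
    have hθ' : θ = (Polynomial.eval₂RingHom ι lam).comp (Polynomial.mapRingHom jC) := by
      ext <;> simp [hθ]
    have hevinj : Function.Injective (Polynomial.eval₂RingHom ι lam) := by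
      intro p q hpq
      apply Polynomial.C_injective
      apply halg
      simpa [evalLM] using hpq
    have hjinj : Function.Injective (Polynomial.mapRingHom jC) :=
      Polynomial.map_injective jC jC.injective
    have hθinj : Function.Injective θ := by
      rw [hθ']; exact hevinj.comp hjinj
    have hann : Polynomial.aeval T (g.map θ) = 0 := by
      have hz : Ψ * Polynomial.aeval T (g.map θ) = 0 := by
        apply Matrix.ext_of_mulVec_single
        intro i
        have hv : dVec dE (Pi.single i (1 : E)) = 0 := by
          ext j
          by_cases hj : j = i
          · subst hj; simp [dVec, d_one hdE]
          · simp [dVec, hj, d_zero hdE]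
        rw [← apply_fund (ι.comp jC) hdE ι lam hlam A0 A1 hA1 n Bc Ψ T hΨ hT hTd _ hv g, hg,
          Matrix.zero_mulVec]
      have := congrArg (Ψ⁻¹ * ·) hz
      simpa [← mul_assoc, Matrix.nonsing_inv_mul _ hΨu] using this
    have hdv := charpoly_dvd_pow T _ hann
    have hf1 : ((-1) ^ l * fC).map (Polynomial.mapRingHom jC) = (M0 dK n A0 A1 Bc).charpoly := by
      rw [Polynomial.map_mul, hfC, fSpec_eq, ← mul_assoc]
      simp only [Polynomial.map_pow, Polynomial.map_neg, Polynomial.map_one]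
      exact neg_one_cancel l _
    have hmon : ((-1) ^ l * fC).Monic := by
      apply Polynomial.monic_of_injective hjinj
      rw [hf1]
      exact Matrix.charpoly_monic _
    have hf2 : ((-1) ^ l * fC).map θ = T.charpoly := by
      rw [hθ', ← Polynomial.map_map, hf1, ← Matrix.charpoly_map,
        M0_map hdE dK ι hcomp lam hlam, ← hN, ← hM, hTdef, Matrix.charpoly_mul_comm,
        ← mul_assoc, Matrix.mul_nonsing_inv _ hΨu, one_mul]
    rw [← hf2, ← Polynomial.map_pow, Polynomial.map_dvd_map θ hθinj hmon] at hdv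
    have hfg : fC ∣ g ^ l := (Dvd.intro_left _ rfl).trans hdv
    have hprime : ∀ i, Prime (h i) := fun i => (hirr i).prime
    have hhg : ∀ i, h i ∣ g := fun i => (hprime i).dvd_of_dvd_pow ((hdvd i).trans hfg)
    have : ∀ S : Finset (Fin s), (∏ i ∈ S, h i) ∣ g := by
      intro S
      induction S using Finset.induction_on with
      | empty => simp
      | insert a S ha ih =>
        rw [Finset.prod_insert ha]
        obtain ⟨q, hq⟩ := ih
        have h1 := hhg a
        rw [hq] at h1
        rcases (hprime a).dvd_or_dvd h1 with h2 | h2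
        · obtain ⟨b, hb, h3⟩ := (hprime a).exists_mem_finset_dvd h2
          exact absurd ((hprime a).associated_of_dvd (hprime b) h3)
            (hna a b (fun e => ha (e ▸ hb)))
        · obtain ⟨r, hr⟩ := h2
          exact ⟨r, by rw [hq, hr]; ring⟩
    exact this Finset.univ
  · intro hf g hfg ψ
    let Lh : AddMonoid.End (Fin l → E) := AddMonoidHom.mk' _ (opP_add hdE ι A0 A1)
    let Bh : AddMonoid.End (Fin l → E) := AddMonoidHom.mk' _ (opQ_add hdE ι n Bc)
    obtain ⟨Φ, hΦ⟩ := applyPoly_eq (ι.comp jC) Lh Bh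
      (fun c v => opP_smul hdE ι A0 A1 (hιc c) v)
      (fun c v => opQ_smul hdE ι n Bc (hιc c) v)
      (by ext1 v; exact hcomm v)
    have hΦ' : ∀ g ψ, applyPoly (ι.comp jC) (opP ι dE A0 A1) (opQ ι dE n Bc) g ψ = Φ g ψ := hΦ
    obtain ⟨q, rfl⟩ := hfg
    rw [hΦ', map_mul]
    exact (hΦ' fC (Φ q ψ)).symm.trans (hf _)
end
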